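/- In the resolvent-sequence setting, if (H1) or (H2) or (H3) holds, then for every ε with 0 < ε < β/12: |λₙ|^{min(ℓ/2 + 1, ℓ)} ∫_ε^{β−ε} |v⁵ₙ′|² dx → 0 as n → ∞. -/

import Mathlib

open Set Filter MeasureTheory

noncomputable section

/-- The resolvent-sequence setting for the locally damped Bresse system with
parameter `ℓ`: a sequence of nonzero frequencies `lam n` with `|lam n| → ∞`,
solutions `Uₙ = (v1,…,v6)` and right-hand sides `Fₙ = (f1,…,f6)` of the resolvent
equations `(lam n)^ℓ (i (lam n) I − 𝒜) Uₙ = Fₙ`, with `‖Uₙ‖_H = 1` and `‖Fₙ‖_H → 0`. -/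
structure BresseSetting (ρ₁ ρ₂ k₁ k₂ k₃ l L β a₀ : ℝ) (ℓ : ℕ) where
  lam : ℕ → ℝ
  v1 : ℕ → ℝ → ℂ
  v2 : ℕ → ℝ → ℂ
  v3 : ℕ → ℝ → ℂ
  v4 : ℕ → ℝ → ℂ
  v5 : ℕ → ℝ → ℂ
  v6 : ℕ → ℝ → ℂ
  f1 : ℕ → ℝ → ℂ
  f2 : ℕ → ℝ → ℂ
  f3 : ℕ → ℝ → ℂ
  f4 : ℕ → ℝ → ℂ
  f5 : ℕ → ℝ → ℂ
  f6 : ℕ → ℝ → ℂ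
  lam_ne : ∀ n, lam n ≠ 0
  lam_tendsto : Tendsto (fun n => |lam n|) atTop atTop
  reg_v1 : ∀ n, ContDiffOn ℝ 2 (v1 n) (Icc 0 L)
  reg_v3 : ∀ n, ContDiffOn ℝ 2 (v3 n) (Icc 0 L)
  reg_v5 : ∀ n, ContDiffOn ℝ 1 (v5 n) (Icc 0 L)
  reg_v5_left : ∀ n, ContDiffOn ℝ 2 (v5 n) (Icc 0 β)
  reg_v5_right : ∀ n, ContDiffOn ℝ 2 (v5 n) (Icc β L)
  reg_v2 : ∀ n, ContDiffOn ℝ 1 (v2 n) (Icc 0 L)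
  reg_v4 : ∀ n, ContDiffOn ℝ 1 (v4 n) (Icc 0 L)
  reg_v6 : ∀ n, ContDiffOn ℝ 1 (v6 n) (Icc 0 L)
  reg_f1 : ∀ n, ContDiffOn ℝ 1 (f1 n) (Icc 0 L)
  reg_f3 : ∀ n, ContDiffOn ℝ 1 (f3 n) (Icc 0 L)
  reg_f5 : ∀ n, ContDiffOn ℝ 1 (f5 n) (Icc 0 L)
  reg_f2 : ∀ n, ContinuousOn (f2 n) (Icc 0 L)
  reg_f4 : ∀ n, ContinuousOn (f4 n) (Icc 0 L)
  reg_f6 : ∀ n, ContinuousOn (f6 n) (Icc 0 L)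
  bc_zero : ∀ n, v1 n 0 = 0 ∧ v2 n 0 = 0 ∧ v3 n 0 = 0 ∧ v4 n 0 = 0 ∧ v5 n 0 = 0 ∧
      v6 n 0 = 0 ∧ f1 n 0 = 0 ∧ f3 n 0 = 0 ∧ f5 n 0 = 0
  bc_L : ∀ n, v1 n L = 0 ∧ v2 n L = 0 ∧ v3 n L = 0 ∧ v4 n L = 0 ∧ v5 n L = 0 ∧
      v6 n L = 0 ∧ f1 n L = 0 ∧ f3 n L = 0 ∧ f5 n L = 0
  eq1 : ∀ n, ∀ x ∈ Ioo (0 : ℝ) β ∪ Ioo β L,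
      Complex.I * (lam n : ℂ) * v1 n x - v2 n x = (lam n : ℂ) ^ (-(ℓ : ℤ)) * f1 n x
  eq2 : ∀ n, ∀ x ∈ Ioo (0 : ℝ) β ∪ Ioo β L,
      Complex.I * (lam n : ℂ) * (ρ₁ : ℂ) * v2 n x
        - (k₁ : ℂ) * deriv (fun y => deriv (v1 n) y + v3 n y + (l : ℂ) * v5 n y) x
        - (l : ℂ) * (k₃ : ℂ) * (deriv (v5 n) x - (l : ℂ) * v1 n x)
        = (ρ₁ : ℂ) * (lam n : ℂ) ^ (-(ℓ : ℤ)) * f2 n x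
  eq3 : ∀ n, ∀ x ∈ Ioo (0 : ℝ) β ∪ Ioo β L,
      Complex.I * (lam n : ℂ) * v3 n x - v4 n x = (lam n : ℂ) ^ (-(ℓ : ℤ)) * f3 n x
  eq4 : ∀ n, ∀ x ∈ Ioo (0 : ℝ) β ∪ Ioo β L,
      Complex.I * (lam n : ℂ) * (ρ₂ : ℂ) * v4 n x
        - (k₂ : ℂ) * deriv (deriv (v3 n)) x
        + (k₁ : ℂ) * (deriv (v1 n) x + v3 n x + (l : ℂ) * v5 n x)
        = (ρ₂ : ℂ) * (lam n : ℂ) ^ (-(ℓ : ℤ)) * f4 n x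
  eq5 : ∀ n, ∀ x ∈ Ioo (0 : ℝ) β ∪ Ioo β L,
      Complex.I * (lam n : ℂ) * v5 n x - v6 n x = (lam n : ℂ) ^ (-(ℓ : ℤ)) * f5 n x
  eq6 : ∀ n, ∀ x ∈ Ioo (0 : ℝ) β ∪ Ioo β L,
      Complex.I * (lam n : ℂ) * (ρ₁ : ℂ) * v6 n x
        - (k₃ : ℂ) * deriv (fun y => deriv (v5 n) y - (l : ℂ) * v1 n y) x
        + (l : ℂ) * (k₁ : ℂ) * (deriv (v1 n) x + v3 n x + (l : ℂ) * v5 n x)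
        + (if x < β then (a₀ : ℂ) else 0) * v6 n x
        = (ρ₁ : ℂ) * (lam n : ℂ) ^ (-(ℓ : ℤ)) * f6 n x
  normU : ∀ n, (∫ x in (0 : ℝ)..L,
      (k₁ * ‖deriv (v1 n) x + v3 n x + (l : ℂ) * v5 n x‖ ^ 2 + ρ₁ * ‖v2 n x‖ ^ 2
        + k₂ * ‖deriv (v3 n) x‖ ^ 2 + ρ₂ * ‖v4 n x‖ ^ 2
        + k₃ * ‖deriv (v5 n) x - (l : ℂ) * v1 n x‖ ^ 2 + ρ₁ * ‖v6 n x‖ ^ 2)) = 1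
  normF : Tendsto (fun n => ∫ x in (0 : ℝ)..L,
      (k₁ * ‖deriv (f1 n) x + f3 n x + (l : ℂ) * f5 n x‖ ^ 2 + ρ₁ * ‖f2 n x‖ ^ 2
        + k₂ * ‖deriv (f3 n) x‖ ^ 2 + ρ₂ * ‖f4 n x‖ ^ 2
        + k₃ * ‖deriv (f5 n) x - (l : ℂ) * f1 n x‖ ^ 2 + ρ₁ * ‖f6 n x‖ ^ 2))
      atTop (nhds 0)


lemma bl_alg1 (lam mu ρ₁ ρ₂ k₁ k₂ k₃ l a : ℝ)
    (v1 v2 v3 v4 v5 v6 d1 d3 d5 f1 f2 f3 f4 f5 f6 e1 e3 e5 s1 t3 s5 : ℂ)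
    (h1 : Complex.I * (lam : ℂ) * v1 - v2 = (mu : ℂ) * f1)
    (h3 : Complex.I * (lam : ℂ) * v3 - v4 = (mu : ℂ) * f3)
    (h5 : Complex.I * (lam : ℂ) * v5 - v6 = (mu : ℂ) * f5)
    (h2 : Complex.I * (lam : ℂ) * (ρ₁ : ℂ) * v2 - (k₁ : ℂ) * s1
        - (l : ℂ) * (k₃ : ℂ) * (d5 - (l : ℂ) * v1) = (ρ₁ : ℂ) * (mu : ℂ) * f2)
    (h4 : Complex.I * (lam : ℂ) * (ρ₂ : ℂ) * v4 - (k₂ : ℂ) * t3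
        + (k₁ : ℂ) * (d1 + v3 + (l : ℂ) * v5) = (ρ₂ : ℂ) * (mu : ℂ) * f4)
    (h6 : Complex.I * (lam : ℂ) * (ρ₁ : ℂ) * v6 - (k₃ : ℂ) * s5
        + (l : ℂ) * (k₁ : ℂ) * (d1 + v3 + (l : ℂ) * v5) + (a : ℂ) * v6
        = (ρ₁ : ℂ) * (mu : ℂ) * f6) :
    k₁ * (inner ℝ (d1 + v3 + (l : ℂ) * v5) (Complex.I * (lam : ℂ) * d1 - (mu : ℂ) * e1)
        + inner ℝ s1 v2)
      + k₂ * (inner ℝ d3 (Complex.I * (lam : ℂ) * d3 - (mu : ℂ) * e3) + inner ℝ t3 v4)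
      + k₃ * (inner ℝ (d5 - (l : ℂ) * v1) (Complex.I * (lam : ℂ) * d5 - (mu : ℂ) * e5)
        + inner ℝ s5 v6)
    = a * ‖v6‖ ^ 2 - mu * (k₁ * inner ℝ (d1 + v3 + (l : ℂ) * v5) (e1 + f3 + (l : ℂ) * f5)
      + ρ₁ * inner ℝ v2 f2 + k₂ * inner ℝ d3 e3 + ρ₂ * inner ℝ v4 f4
      + k₃ * inner ℝ (d5 - (l : ℂ) * v1) (e5 - (l : ℂ) * f1) + ρ₁ * inner ℝ v6 f6) := by
  have q1 : v2 = Complex.I * (lam : ℂ) * v1 - (mu : ℂ) * f1 := by linear_combination -h1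
  have q3 : v4 = Complex.I * (lam : ℂ) * v3 - (mu : ℂ) * f3 := by linear_combination -h3
  have q5 : v6 = Complex.I * (lam : ℂ) * v5 - (mu : ℂ) * f5 := by linear_combination -h5
  obtain ⟨h2r, h2i⟩ := Complex.ext_iff.1 h2
  obtain ⟨h4r, h4i⟩ := Complex.ext_iff.1 h4
  obtain ⟨h6r, h6i⟩ := Complex.ext_iff.1 h6
  obtain ⟨q1r, q1i⟩ := Complex.ext_iff.1 q1
  obtain ⟨q3r, q3i⟩ := Complex.ext_iff.1 q3
  obtain ⟨q5r, q5i⟩ := Complex.ext_iff.1 q5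
  clear h1 h2 h3 h4 h5 h6 q1 q3 q5
  simp only [Complex.inner, ← Complex.normSq_eq_norm_sq, Complex.normSq_apply, Complex.mul_re, Complex.mul_im, Complex.sub_re,
    Complex.sub_im, Complex.add_re, Complex.add_im, Complex.I_re, Complex.I_im, Complex.ofReal_re,
    Complex.ofReal_im, Complex.conj_re, Complex.conj_im] at *
  set S1r := d1.re + v3.re + l * v5.re
  set S1i := d1.im + v3.im + l * v5.im
  linear_combination (-v2.re) * h2r - v2.im * h2i - v4.re * h4r - v4.im * h4i - v6.re * h6r
    - v6.im * h6i + k₃ * l * (-(d5.re - l * v1.re) * q1r - (d5.im - l * v1.im) * q1i)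
    + k₁ * ((d1.re + v3.re + l * v5.re) * (q3r + l * q5r)
      + (d1.im + v3.im + l * v5.im) * (q3i + l * q5i))

lemma bl_young (z w : ℂ) {δ : ℝ} (hδ : 0 < δ) :
    inner ℝ z w ≤ δ * ‖z‖ ^ 2 + ‖w‖ ^ 2 / δ := by
  have h := real_inner_le_norm z w
  have h2 : ‖z‖ * ‖w‖ ≤ δ * ‖z‖ ^ 2 + ‖w‖ ^ 2 / δ := by
    have : δ * ‖z‖ ^ 2 + ‖w‖ ^ 2 / δ - ‖z‖ * ‖w‖
        = ((δ * ‖z‖ - ‖w‖) ^ 2 + δ * ‖z‖ * ‖w‖) / δ := by field_simp; ring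
    have h3 : 0 ≤ ((δ * ‖z‖ - ‖w‖) ^ 2 + δ * ‖z‖ * ‖w‖) / δ := by positivity
    linarith
  linarith

lemma bl_reg1 {v : ℝ → ℂ} {a b : ℝ} (hab : a < b) (h : ContDiffOn ℝ 1 v (Icc a b)) :
    ContinuousOn (derivWithin v (Icc a b)) (Icc a b) ∧
    ∀ x ∈ Ioo a b, HasDerivAt v (derivWithin v (Icc a b) x) x ∧
      deriv v x = derivWithin v (Icc a b) x := by
  refine ⟨h.continuousOn_derivWithin (uniqueDiffOn_Icc hab) le_rfl, fun x hx => ?_⟩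
  have hn : Icc a b ∈ nhds x := Icc_mem_nhds hx.1 hx.2
  have e : derivWithin v (Icc a b) x = deriv v x := derivWithin_of_mem_nhds hn
  have hd : DifferentiableAt ℝ v x :=
    (h.differentiableOn one_ne_zero x (Ioo_subset_Icc_self hx)).differentiableAt hn
  exact ⟨e ▸ hd.hasDerivAt, e.symm⟩

lemma bl_reg2 {v : ℝ → ℂ} {a b : ℝ} (h : ContDiffOn ℝ 2 v (Icc a b)) :
    ∀ x ∈ Ioo a b, DifferentiableAt ℝ (deriv v) x := by
  intro x hx
  have h' : ContDiffOn ℝ (1 + 1) v (Ioo a b) := by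
    have := h.mono Ioo_subset_Icc_self
    norm_num
    exact this
  have := ((contDiffOn_succ_iff_deriv_of_isOpen isOpen_Ioo).1 h').2.2
  exact (this.differentiableOn one_ne_zero x hx).differentiableAt (isOpen_Ioo.mem_nhds hx)

lemma bl_poin {w g : ℝ → ℂ} {L c : ℝ} (hL : 0 < L) (hw : ContinuousOn w (Icc 0 L))
    (hg : ContinuousOn g (Icc 0 L)) (h0 : w 0 = 0)
    (hd : ∀ x ∈ Ioo 0 L, HasDerivAt w (Complex.I * c * w x + g x) x) :
    ∫ x in (0 : ℝ)..L, ‖w x‖ ^ 2 ≤ L ^ 2 * ∫ x in (0 : ℝ)..L, ‖g x‖ ^ 2 := by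
  have hgn : ContinuousOn (fun x => ‖g x‖) (uIcc 0 L) := by
    rw [uIcc_of_le hL.le]; exact hg.norm
  have i1 : IntervalIntegrable (fun x => ‖g x‖) volume 0 L := hgn.intervalIntegrable
  have i2 : IntervalIntegrable (fun x => ‖g x‖ ^ 2) volume 0 L := (hgn.pow 2).intervalIntegrable
  set I := ∫ x in (0 : ℝ)..L, ‖g x‖ with hI
  set J := ∫ x in (0 : ℝ)..L, ‖g x‖ ^ 2 with hJ
  have hI0 : 0 ≤ I := intervalIntegral.integral_nonneg hL.le (fun x _ => norm_nonneg _)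
  have cs : I ^ 2 ≤ L * J := by
    have : ∫ x in (0 : ℝ)..L, (2 * (I / L) * ‖g x‖ - (I / L) ^ 2) ≤ J := by
      apply intervalIntegral.integral_mono_on hL.le _ i2
      · intro x _
        nlinarith [sq_nonneg (I / L - ‖g x‖)]
      · exact (i1.const_mul _).sub intervalIntegrable_const
    rw [intervalIntegral.integral_sub (i1.const_mul _) intervalIntegrable_const,
      intervalIntegral.integral_const_mul, intervalIntegral.integral_const, ← hI] at this
    have e : 2 * (I / L) * I - (L - 0) • (I / L) ^ 2 = I ^ 2 / L := by
      simp only [smul_eq_mul]; field_simp; ring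
    rw [e, div_le_iff₀ hL] at this
    linarith
  have pt : ∀ x ∈ Icc 0 L, ‖w x‖ ^ 2 ≤ L * J := by
    intro x hx
    have hsub : Icc 0 x ⊆ Icc 0 L := Icc_subset_Icc le_rfl hx.2
    have hexpn : ∀ y : ℝ, ‖Complex.exp (-(Complex.I * c * y))‖ = 1 := by
      intro y
      rw [Complex.norm_exp]; simp
    have ftc : ∫ y in (0 : ℝ)..x, Complex.exp (-(Complex.I * c * y)) * g y
        = Complex.exp (-(Complex.I * c * x)) * w x
          - Complex.exp (-(Complex.I * c * (0 : ℝ))) * w 0 := by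
      have hc : Continuous (fun y : ℝ => Complex.exp (-(Complex.I * c * y))) := by fun_prop
      apply intervalIntegral.integral_eq_sub_of_hasDerivAt_of_le hx.1
        (f := fun y : ℝ => Complex.exp (-(Complex.I * c * y)) * w y)
      · exact hc.continuousOn.mul (hw.mono hsub)
      · intro y hy
        have h1 := hd y ⟨hy.1, hy.2.trans_le hx.2⟩
        have h2 : HasDerivAt (fun y : ℝ => -(Complex.I * c * (y : ℂ))) (-(Complex.I * c)) y := by
          have h3 := (Complex.ofRealCLM.hasDerivAt (x := y)).const_mul (Complex.I * (c : ℂ))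
          simp only [Complex.ofRealCLM_apply, Complex.ofReal_one, mul_one] at h3
          exact h3.fun_neg
        refine (h2.cexp.mul h1).congr_deriv ?_
        ring
      · apply ContinuousOn.intervalIntegrable
        rw [uIcc_of_le hx.1]
        exact hc.continuousOn.mul (hg.mono hsub)
    have h1 : ‖w x‖ ≤ I := by
      have e1 : ‖w x‖ = ‖∫ y in (0 : ℝ)..x, Complex.exp (-(Complex.I * c * y)) * g y‖ := by
        rw [ftc, h0, mul_zero, sub_zero, norm_mul, hexpn, one_mul]
      rw [e1]
      refine (intervalIntegral.norm_integral_le_integral_norm hx.1).trans ?_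
      simp only [norm_mul, hexpn, one_mul]
      exact intervalIntegral.integral_mono_interval le_rfl hx.1 hx.2
        (Eventually.of_forall fun y => norm_nonneg _) i1
    calc ‖w x‖ ^ 2 ≤ I ^ 2 := by gcongr
      _ ≤ _ := cs
  calc ∫ x in (0 : ℝ)..L, ‖w x‖ ^ 2 ≤ ∫ x in (0 : ℝ)..L, L * J := by
        apply intervalIntegral.integral_mono_on hL.le _ intervalIntegrable_const pt
        apply ContinuousOn.intervalIntegrable
        rw [uIcc_of_le hL.le]
        exact hw.norm.pow 2
    _ = L ^ 2 * J := by
        rw [intervalIntegral.integral_const]; simp only [smul_eq_mul]; ring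

lemma bl_lim {x T : ℕ → ℝ} {A B : ℝ} (hA : 0 < A) (hT : Tendsto T atTop (nhds 0))
    (hx : ∀ᶠ n in atTop, 0 ≤ x n)
    (h : ∀ᶠ n in atTop, ∀ δ : ℝ, 0 < δ → x n ≤ A * δ + (B + A / δ) * T n) :
    Tendsto x atTop (nhds 0) := by
  rw [tendsto_order]
  refine ⟨fun a ha => hx.mono fun n hn => ha.trans_le hn, fun a ha => ?_⟩
  have hδ : 0 < a / (2 * A) := by positivity
  have h2 : Tendsto (fun n => A * (a / (2 * A)) + (B + A / (a / (2 * A))) * T n) atTop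
      (nhds (A * (a / (2 * A)) + (B + A / (a / (2 * A))) * 0)) :=
    (hT.const_mul _).const_add _
  have h3 : A * (a / (2 * A)) + (B + A / (a / (2 * A))) * 0 < a := by
    have : A * (a / (2 * A)) = a / 2 := by field_simp
    rw [this]; linarith
  filter_upwards [h, h2.eventually_lt_const h3] with n hn hn2
  exact (hn _ hδ).trans_lt hn2

lemma bl_ii {f : ℝ → ℝ} {a b : ℝ} (hab : a ≤ b) (h : ContinuousOn f (Icc a b)) :
    IntervalIntegrable f volume a b := by
  apply ContinuousOn.intervalIntegrable
  rwa [uIcc_of_le hab]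

lemma bl_isq {f : ℝ → ℂ} {a b : ℝ} (hab : a ≤ b) (h : ContinuousOn f (Icc a b)) :
    IntervalIntegrable (fun x => ‖f x‖ ^ 2) volume a b :=
  bl_ii hab (h.norm.pow 2)

lemma bl_coer0 {L : ℝ} (l : ℝ) (hL : 0 < L) (w1 w3 w5 d1 d3 d5 : ℝ → ℂ)
    (c1 : ContinuousOn w1 (Icc 0 L)) (c3 : ContinuousOn w3 (Icc 0 L))
    (c5 : ContinuousOn w5 (Icc 0 L)) (cd1 : ContinuousOn d1 (Icc 0 L))
    (cd3 : ContinuousOn d3 (Icc 0 L)) (cd5 : ContinuousOn d5 (Icc 0 L))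
    (z1 : w1 0 = 0) (z3 : w3 0 = 0) (z5 : w5 0 = 0)
    (h1 : ∀ x ∈ Ioo 0 L, HasDerivAt w1 (d1 x) x) (h3 : ∀ x ∈ Ioo 0 L, HasDerivAt w3 (d3 x) x)
    (h5 : ∀ x ∈ Ioo 0 L, HasDerivAt w5 (d5 x) x) :
    ∫ x in (0 : ℝ)..L, (‖w1 x‖ ^ 2 + ‖w3 x‖ ^ 2 + ‖w5 x‖ ^ 2) ≤
      (2 * L ^ 4 + 2 * L ^ 2) * ∫ x in (0 : ℝ)..L, (‖d1 x + w3 x + (l : ℂ) * w5 x‖ ^ 2 + ‖d3 x‖ ^ 2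
        + ‖d5 x - (l : ℂ) * w1 x‖ ^ 2) := by
  have cS : ContinuousOn (fun x => d1 x + w3 x + (l : ℂ) * w5 x) (Icc 0 L) :=
    (cd1.add c3).add (continuousOn_const.mul c5)
  have cT : ContinuousOn (fun x => d5 x - (l : ℂ) * w1 x) (Icc 0 L) :=
    cd5.sub (continuousOn_const.mul c1)
  have p3 := bl_poin (c := 0) hL c3 cd3 z3 (fun x hx => by simpa using h3 x hx)
  have pP := bl_poin (w := fun x => w1 x + Complex.I * w5 x)
    (g := fun x => (d1 x + (l : ℂ) * w5 x) + Complex.I * (d5 x - (l : ℂ) * w1 x)) (c := l) hL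
    (c1.add (continuousOn_const.mul c5))
    ((cd1.add (continuousOn_const.mul c5)).add (continuousOn_const.mul cT)) (by simp [z1, z5])
    (fun x hx => ((h1 x hx).add ((h5 x hx).const_mul Complex.I)).congr_deriv (by
      linear_combination (-(l : ℂ) * w5 x) * Complex.I_sq))
  have pQ := bl_poin (w := fun x => w1 x - Complex.I * w5 x)
    (g := fun x => (d1 x + (l : ℂ) * w5 x) - Complex.I * (d5 x - (l : ℂ) * w1 x)) (c := -l) hL
    (c1.sub (continuousOn_const.mul c5))
    ((cd1.add (continuousOn_const.mul c5)).sub (continuousOn_const.mul cT)) (by simp [z1, z5])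
    (fun x hx => ((h1 x hx).sub ((h5 x hx).const_mul Complex.I)).congr_deriv (by
      push_cast
      linear_combination (-(l : ℂ) * w5 x) * Complex.I_sq))
  have par : ∀ z w : ℂ, ‖z + Complex.I * w‖ ^ 2 + ‖z - Complex.I * w‖ ^ 2
      = 2 * (‖z‖ ^ 2 + ‖w‖ ^ 2) := by
    intro z w
    simp only [← Complex.normSq_eq_norm_sq, Complex.normSq_apply, Complex.mul_re, Complex.mul_im,
      Complex.sub_re, Complex.sub_im, Complex.add_re, Complex.add_im, Complex.I_re, Complex.I_im]
    ring
  have q1 := bl_isq hL.le c1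
  have q3 := bl_isq hL.le c3
  have q5 := bl_isq hL.le c5
  have qd3 := bl_isq hL.le cd3
  have qS := bl_isq hL.le cS
  have qT := bl_isq hL.le cT
  have cg : ContinuousOn (fun x => d1 x + (l : ℂ) * w5 x) (Icc 0 L) :=
    cd1.add (continuousOn_const.mul c5)
  have qg := bl_isq hL.le cg
  have s1 := add_le_add pP pQ
  rw [← mul_add, ← intervalIntegral.integral_add, ← intervalIntegral.integral_add] at s1
  rotate_left
  · exact bl_ii hL.le (((cd1.add (continuousOn_const.mul c5)).add
      (continuousOn_const.mul cT)).norm.pow 2)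
  · exact bl_ii hL.le (((cd1.add (continuousOn_const.mul c5)).sub
      (continuousOn_const.mul cT)).norm.pow 2)
  · exact bl_ii hL.le ((c1.add (continuousOn_const.mul c5)).norm.pow 2)
  · exact bl_ii hL.le ((c1.sub (continuousOn_const.mul c5)).norm.pow 2)
  simp only [par] at s1
  rw [intervalIntegral.integral_const_mul, intervalIntegral.integral_const_mul] at s1
  have s2 : ∫ x in (0 : ℝ)..L, (‖d1 x + (l : ℂ) * w5 x‖ ^ 2 + ‖d5 x - (l : ℂ) * w1 x‖ ^ 2) ≤
      ∫ x in (0 : ℝ)..L, (2 * ‖d1 x + w3 x + (l : ℂ) * w5 x‖ ^ 2 + 2 * ‖w3 x‖ ^ 2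
        + ‖d5 x - (l : ℂ) * w1 x‖ ^ 2) := by
    apply intervalIntegral.integral_mono_on hL.le (qg.add qT)
      (((qS.const_mul 2).add (q3.const_mul 2)).add qT)
    intro x _
    have e : d1 x + (l : ℂ) * w5 x = (d1 x + w3 x + (l : ℂ) * w5 x) - w3 x := by ring
    have := norm_sub_le (d1 x + w3 x + (l : ℂ) * w5 x) (w3 x)
    rw [← e] at this
    have h0 := norm_nonneg (d1 x + (l : ℂ) * w5 x)
    nlinarith [sq_nonneg (‖d1 x + w3 x + (l : ℂ) * w5 x‖ - ‖w3 x‖)]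
  rw [intervalIntegral.integral_add ((qS.const_mul 2).add (q3.const_mul 2)) qT,
    intervalIntegral.integral_add (qS.const_mul 2) (q3.const_mul 2),
    intervalIntegral.integral_const_mul, intervalIntegral.integral_const_mul] at s2
  rw [intervalIntegral.integral_add q1 q5] at s1
  rw [intervalIntegral.integral_add (q1.add q3) q5, intervalIntegral.integral_add q1 q3,
    intervalIntegral.integral_add (qS.add qd3) qT, intervalIntegral.integral_add qS qd3]
  have n1 : 0 ≤ ∫ x in (0 : ℝ)..L, ‖d1 x + w3 x + (l : ℂ) * w5 x‖ ^ 2 :=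
    intervalIntegral.integral_nonneg hL.le (fun x _ => by positivity)
  have n3 : 0 ≤ ∫ x in (0 : ℝ)..L, ‖d3 x‖ ^ 2 :=
    intervalIntegral.integral_nonneg hL.le (fun x _ => by positivity)
  have n5 : 0 ≤ ∫ x in (0 : ℝ)..L, ‖d5 x - (l : ℂ) * w1 x‖ ^ 2 :=
    intervalIntegral.integral_nonneg hL.le (fun x _ => by positivity)
  have hL2 : 0 ≤ L ^ 2 := by positivity
  have hL4 : 0 ≤ L ^ 4 := by positivity
  have s3 := mul_le_mul_of_nonneg_left s2 hL2
  have s4 := mul_le_mul_of_nonneg_left p3 hL2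
  nlinarith [mul_nonneg hL4 n1, mul_nonneg hL4 n5, mul_nonneg hL2 n1, mul_nonneg hL2 n3,
    mul_nonneg hL2 n5]

lemma bl_sq3 (d w z : ℂ) (l : ℝ) :
    ‖d‖ ^ 2 ≤ 3 * ‖d + w + (l : ℂ) * z‖ ^ 2 + 3 * ‖w‖ ^ 2 + 3 * (l ^ 2 * ‖z‖ ^ 2) := by
  have e : d = (d + w + (l : ℂ) * z) - w - (l : ℂ) * z := by ring
  have h1 : ‖d‖ ≤ ‖d + w + (l : ℂ) * z‖ + ‖w‖ + ‖(l : ℂ) * z‖ := by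
    calc ‖d‖ = ‖(d + w + (l : ℂ) * z) - w - (l : ℂ) * z‖ := by rw [← e]
      _ ≤ ‖(d + w + (l : ℂ) * z) - w‖ + ‖(l : ℂ) * z‖ := norm_sub_le _ _
      _ ≤ _ := by gcongr; exact norm_sub_le _ _
  have h2 : ‖(l : ℂ) * z‖ ^ 2 = l ^ 2 * ‖z‖ ^ 2 := by
    rw [norm_mul, mul_pow, Complex.norm_real, Real.norm_eq_abs, sq_abs]
  rw [← h2]
  generalize ‖d + w + (l : ℂ) * z‖ = a at *
  generalize ‖(l : ℂ) * z‖ = b at *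
  have h0 := norm_nonneg d
  nlinarith [sq_nonneg (a - b), sq_nonneg (a - ‖w‖), sq_nonneg (b - ‖w‖)]

lemma bl_sq2 (d w : ℂ) (l : ℝ) :
    ‖d‖ ^ 2 ≤ 2 * ‖d - (l : ℂ) * w‖ ^ 2 + 2 * (l ^ 2 * ‖w‖ ^ 2) := by
  have e : d = (d - (l : ℂ) * w) + (l : ℂ) * w := by ring
  have h1 : ‖d‖ ≤ ‖d - (l : ℂ) * w‖ + ‖(l : ℂ) * w‖ := by
    calc ‖d‖ = ‖(d - (l : ℂ) * w) + (l : ℂ) * w‖ := by rw [← e]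
      _ ≤ _ := norm_add_le _ _
  have h2 : ‖(l : ℂ) * w‖ ^ 2 = l ^ 2 * ‖w‖ ^ 2 := by
    rw [norm_mul, mul_pow, Complex.norm_real, Real.norm_eq_abs, sq_abs]
  rw [← h2]
  have h0 := norm_nonneg d
  nlinarith [sq_nonneg (‖d - (l : ℂ) * w‖ - ‖(l : ℂ) * w‖)]

set_option maxHeartbeats 800000 in
lemma bl_coer {L ρ₁ ρ₂ k₁ k₂ k₃ : ℝ} (l : ℝ) (hL : 0 < L) (hrho1 : 0 < ρ₁) (hrho2 : 0 < ρ₂)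
    (hk1 : 0 < k₁) (hk2 : 0 < k₂) (hk3 : 0 < k₃) :
    ∃ C : ℝ, 0 < C ∧ ∀ (w1 w2 w3 w4 w5 w6 d1 d3 d5 : ℝ → ℂ)
    (_ : ContinuousOn w1 (Icc 0 L)) (_ : ContinuousOn w2 (Icc 0 L))
    (_ : ContinuousOn w3 (Icc 0 L)) (_ : ContinuousOn w4 (Icc 0 L))
    (_ : ContinuousOn w5 (Icc 0 L)) (_ : ContinuousOn w6 (Icc 0 L))
    (_ : ContinuousOn d1 (Icc 0 L))
    (_ : ContinuousOn d3 (Icc 0 L)) (_ : ContinuousOn d5 (Icc 0 L))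
    (_ : w1 0 = 0) (_ : w3 0 = 0) (_ : w5 0 = 0)
    (_ : ∀ x ∈ Ioo 0 L, HasDerivAt w1 (d1 x) x) (_ : ∀ x ∈ Ioo 0 L, HasDerivAt w3 (d3 x) x)
    (_ : ∀ x ∈ Ioo 0 L, HasDerivAt w5 (d5 x) x),
    ∫ x in (0 : ℝ)..L, (‖w5 x‖ ^ 2 + ‖d1 x‖ ^ 2 + ‖d5 x‖ ^ 2
        + ‖d1 x + w3 x + (l : ℂ) * w5 x‖ ^ 2 + ‖w6 x‖ ^ 2) ≤
    C * ∫ x in (0 : ℝ)..L, (k₁ * ‖d1 x + w3 x + (l : ℂ) * w5 x‖ ^ 2 + ρ₁ * ‖w2 x‖ ^ 2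
        + k₂ * ‖d3 x‖ ^ 2 + ρ₂ * ‖w4 x‖ ^ 2
        + k₃ * ‖d5 x - (l : ℂ) * w1 x‖ ^ 2 + ρ₁ * ‖w6 x‖ ^ 2) := by
  set A : ℝ := 4 + 5 * l ^ 2 with hA
  set B : ℝ := 2 * L ^ 4 + 2 * L ^ 2 with hB
  set K : ℝ := 1 / k₁ + 1 / k₂ + 1 / k₃ + 1 / ρ₁ with hK
  have hA0 : 0 < A := by positivity
  have hB0 : 0 < B := by positivity
  have hK0 : 0 < K := by positivity
  refine ⟨(A * B + 4) * K, by positivity, ?_⟩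
  intro w1 w2 w3 w4 w5 w6 d1 d3 d5 c1 c2 c3 c4 c5 c6 cd1 cd3 cd5 z1 z3 z5 h1 h3 h5
  have co := bl_coer0 l hL w1 w3 w5 d1 d3 d5 c1 c3 c5 cd1 cd3 cd5 z1 z3 z5 h1 h3 h5
  have cS : ContinuousOn (fun x => d1 x + w3 x + (l : ℂ) * w5 x) (Icc 0 L) :=
    (cd1.add c3).add (continuousOn_const.mul c5)
  have cT : ContinuousOn (fun x => d5 x - (l : ℂ) * w1 x) (Icc 0 L) :=
    cd5.sub (continuousOn_const.mul c1)
  have q1 := bl_isq hL.le c1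
  have q2 := bl_isq hL.le c2
  have q3 := bl_isq hL.le c3
  have q4 := bl_isq hL.le c4
  have q5 := bl_isq hL.le c5
  have q6 := bl_isq hL.le c6
  have qd1 := bl_isq hL.le cd1
  have qd3 := bl_isq hL.le cd3
  have qd5 := bl_isq hL.le cd5
  have qS := bl_isq hL.le cS
  have qT := bl_isq hL.le cT
  have kk : ∀ k : ℝ, 0 < k → 1 / k ≤ K → ∀ t : ℝ, 0 ≤ t → t ≤ K * (k * t) := by
    intro k hk h t ht
    have : 1 ≤ K * k := by rwa [div_le_iff₀ hk] at h
    nlinarith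
  have k1K : 1 / k₁ ≤ K := by
    have : 0 < 1 / k₂ + 1 / k₃ + 1 / ρ₁ := by positivity
    linarith
  have k2K : 1 / k₂ ≤ K := by
    have : 0 < 1 / k₁ + 1 / k₃ + 1 / ρ₁ := by positivity
    linarith
  have k3K : 1 / k₃ ≤ K := by
    have : 0 < 1 / k₁ + 1 / k₂ + 1 / ρ₁ := by positivity
    linarith
  have r1K : 1 / ρ₁ ≤ K := by
    have : 0 < 1 / k₁ + 1 / k₂ + 1 / k₃ := by positivity
    linarith
  have iN := ((((((qS.const_mul k₁).add (q2.const_mul ρ₁)).add (qd3.const_mul k₂)).add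
      (q4.const_mul ρ₂)).add (qT.const_mul k₃)).add (q6.const_mul ρ₁))
  have i3 := (qS.add qd3).add qT
  have iw := (q1.add q3).add q5
  set N := ∫ x in (0 : ℝ)..L, (k₁ * ‖d1 x + w3 x + (l : ℂ) * w5 x‖ ^ 2 + ρ₁ * ‖w2 x‖ ^ 2
        + k₂ * ‖d3 x‖ ^ 2 + ρ₂ * ‖w4 x‖ ^ 2
        + k₃ * ‖d5 x - (l : ℂ) * w1 x‖ ^ 2 + ρ₁ * ‖w6 x‖ ^ 2) with hN
  have m1 : ∫ x in (0 : ℝ)..L, (‖d1 x + w3 x + (l : ℂ) * w5 x‖ ^ 2 + ‖d3 x‖ ^ 2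
        + ‖d5 x - (l : ℂ) * w1 x‖ ^ 2) ≤ K * N := by
    rw [hN, ← intervalIntegral.integral_const_mul]
    apply intervalIntegral.integral_mono_on hL.le i3 (iN.const_mul K)
    intro x _
    have a1 := kk k₁ hk1 k1K (‖d1 x + w3 x + (l : ℂ) * w5 x‖ ^ 2) (by positivity)
    have a2 := kk k₂ hk2 k2K (‖d3 x‖ ^ 2) (by positivity)
    have a3 := kk k₃ hk3 k3K (‖d5 x - (l : ℂ) * w1 x‖ ^ 2) (by positivity)
    have a4 : 0 ≤ K * (ρ₁ * ‖w2 x‖ ^ 2) := by positivity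
    have a5 : 0 ≤ K * (ρ₂ * ‖w4 x‖ ^ 2) := by positivity
    have a6 : 0 ≤ K * (ρ₁ * ‖w6 x‖ ^ 2) := by positivity
    linarith
  have m2 : ∫ x in (0 : ℝ)..L, (‖w5 x‖ ^ 2 + ‖d1 x‖ ^ 2 + ‖d5 x‖ ^ 2
        + ‖d1 x + w3 x + (l : ℂ) * w5 x‖ ^ 2 + ‖w6 x‖ ^ 2) ≤
      ∫ x in (0 : ℝ)..L, (A * (‖w1 x‖ ^ 2 + ‖w3 x‖ ^ 2 + ‖w5 x‖ ^ 2)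
        + (4 * K) * (k₁ * ‖d1 x + w3 x + (l : ℂ) * w5 x‖ ^ 2 + ρ₁ * ‖w2 x‖ ^ 2
        + k₂ * ‖d3 x‖ ^ 2 + ρ₂ * ‖w4 x‖ ^ 2
        + k₃ * ‖d5 x - (l : ℂ) * w1 x‖ ^ 2 + ρ₁ * ‖w6 x‖ ^ 2)) := by
    apply intervalIntegral.integral_mono_on hL.le ((((q5.add qd1).add qd5).add qS).add q6)
      ((iw.const_mul A).add (iN.const_mul (4 * K)))
    intro x _
    have a1 := kk k₁ hk1 k1K (‖d1 x + w3 x + (l : ℂ) * w5 x‖ ^ 2) (by positivity)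
    have a2 : 0 ≤ K * (k₂ * ‖d3 x‖ ^ 2) := by positivity
    have a3 := kk k₃ hk3 k3K (‖d5 x - (l : ℂ) * w1 x‖ ^ 2) (by positivity)
    have a4 : 0 ≤ K * (ρ₁ * ‖w2 x‖ ^ 2) := by positivity
    have a5 : 0 ≤ K * (ρ₂ * ‖w4 x‖ ^ 2) := by positivity
    have a6 := kk ρ₁ hrho1 r1K (‖w6 x‖ ^ 2) (by positivity)
    have b1 : ‖d1 x‖ ^ 2 ≤ 3 * ‖d1 x + w3 x + (l : ℂ) * w5 x‖ ^ 2 + 3 * ‖w3 x‖ ^ 2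
        + 3 * (l ^ 2 * ‖w5 x‖ ^ 2) := bl_sq3 _ _ _ _
    have b5 : ‖d5 x‖ ^ 2 ≤ 2 * ‖d5 x - (l : ℂ) * w1 x‖ ^ 2 + 2 * (l ^ 2 * ‖w1 x‖ ^ 2) :=
      bl_sq2 _ _ _
    have g1 : 0 ≤ l ^ 2 * ‖w1 x‖ ^ 2 := by positivity
    have g3 : 0 ≤ l ^ 2 * ‖w3 x‖ ^ 2 := by positivity
    have g5 : 0 ≤ l ^ 2 * ‖w5 x‖ ^ 2 := by positivity
    have g1' : 0 ≤ ‖w1 x‖ ^ 2 := by positivity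
    have g3' : 0 ≤ ‖w3 x‖ ^ 2 := by positivity
    have g5' : 0 ≤ ‖w5 x‖ ^ 2 := by positivity
    have g6' : 0 ≤ ‖w6 x‖ ^ 2 := by positivity
    have g7' : 0 ≤ ‖d5 x - (l : ℂ) * w1 x‖ ^ 2 := by positivity
    rw [hA]
    linarith
  rw [intervalIntegral.integral_add (iw.const_mul A) (iN.const_mul (4 * K)),
    intervalIntegral.integral_const_mul, intervalIntegral.integral_const_mul, ← hN] at m2
  have m3 := mul_le_mul_of_nonneg_left (co.trans (mul_le_mul_of_nonneg_left m1 hB0.le)) hA0.le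
  calc _ ≤ _ := m2
    _ ≤ A * (B * (K * N)) + 4 * K * N := by linarith
    _ = _ := by ring

/-- The one-sided-at-the-ends derivative on `[0,L]`. -/
def bl_D (L : ℝ) (v : ℝ → ℂ) : ℝ → ℂ := derivWithin v (Icc 0 L)

lemma bl_ftc {G h : ℝ → ℝ} {L β : ℝ} (hL : 0 ≤ L) (hG : ContinuousOn G (Icc 0 L))
    (hd : ∀ x ∈ Ioo 0 L, x ≠ β → HasDerivAt G (h x) x)
    (hi : IntervalIntegrable h volume 0 L) (g0 : G 0 = 0) (gL : G L = 0) :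
    ∫ x in (0 : ℝ)..L, h x = 0 := by
  rw [integral_eq_of_hasDerivAt_off_countable_of_le G h hL (countable_singleton β) hG
    (fun x hx => hd x hx.1 hx.2) hi, g0, gL, sub_zero]

lemma bl_mem {x L β : ℝ} (hx : x ∈ Ioo 0 L) (hb : x ≠ β) : x ∈ Ioo (0 : ℝ) β ∪ Ioo β L := by
  rcases lt_or_gt_of_ne hb with h | h
  · exact Or.inl ⟨hx.1, h⟩
  · exact Or.inr ⟨h, hx.2⟩

lemma bl_derivs {ρ₁ ρ₂ k₁ k₂ k₃ l L β a₀ : ℝ} {ℓ : ℕ} (hL : 0 < L) (hbeta : 0 < β)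
    (hbetaL : β < L) (S : BresseSetting ρ₁ ρ₂ k₁ k₂ k₃ l L β a₀ ℓ) (n : ℕ) (mu : ℝ)
    (hmu : (S.lam n : ℂ) ^ (-(ℓ : ℤ)) = (mu : ℂ)) {x : ℝ} (hx : x ∈ Ioo 0 L) (hb : x ≠ β) :
    (∃ s1, HasDerivAt (fun y => bl_D L (S.v1 n) y + S.v3 n y + (l : ℂ) * S.v5 n y) s1 x ∧
      Complex.I * (S.lam n : ℂ) * (ρ₁ : ℂ) * S.v2 n x - (k₁ : ℂ) * s1
        - (l : ℂ) * (k₃ : ℂ) * (bl_D L (S.v5 n) x - (l : ℂ) * S.v1 n x)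
        = (ρ₁ : ℂ) * (mu : ℂ) * S.f2 n x) ∧
    (∃ t3, HasDerivAt (bl_D L (S.v3 n)) t3 x ∧
      Complex.I * (S.lam n : ℂ) * (ρ₂ : ℂ) * S.v4 n x - (k₂ : ℂ) * t3
        + (k₁ : ℂ) * (bl_D L (S.v1 n) x + S.v3 n x + (l : ℂ) * S.v5 n x)
        = (ρ₂ : ℂ) * (mu : ℂ) * S.f4 n x) ∧
    (∃ s5, HasDerivAt (fun y => bl_D L (S.v5 n) y - (l : ℂ) * S.v1 n y) s5 x ∧
      Complex.I * (S.lam n : ℂ) * (ρ₁ : ℂ) * S.v6 n x - (k₃ : ℂ) * s5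
        + (l : ℂ) * (k₁ : ℂ) * (bl_D L (S.v1 n) x + S.v3 n x + (l : ℂ) * S.v5 n x)
        + ((if x < β then a₀ else 0 : ℝ) : ℂ) * S.v6 n x
        = (ρ₁ : ℂ) * (mu : ℂ) * S.f6 n x) := by
  have r1 := bl_reg1 hL ((S.reg_v1 n).of_le one_le_two)
  have r3 := bl_reg1 hL ((S.reg_v3 n).of_le one_le_two)
  have r5 := bl_reg1 hL (S.reg_v5 n)
  have hm := bl_mem hx hb
  have nb : Ioo 0 L ∈ nhds x := isOpen_Ioo.mem_nhds hx
  have e1 : deriv (S.v1 n) =ᶠ[nhds x] bl_D L (S.v1 n) := by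
    filter_upwards [nb] with y hy using (r1.2 y hy).2
  have e3 : deriv (S.v3 n) =ᶠ[nhds x] bl_D L (S.v3 n) := by
    filter_upwards [nb] with y hy using (r3.2 y hy).2
  have e5 : deriv (S.v5 n) =ᶠ[nhds x] bl_D L (S.v5 n) := by
    filter_upwards [nb] with y hy using (r5.2 y hy).2
  have q1 := bl_reg2 (S.reg_v1 n) x hx
  have q3 := bl_reg2 (S.reg_v3 n) x hx
  have q5 : DifferentiableAt ℝ (deriv (S.v5 n)) x := by
    rcases hm with h | h
    · exact bl_reg2 (S.reg_v5_left n) x h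
    · exact bl_reg2 (S.reg_v5_right n) x h
  have p1 := (r1.2 x hx).1.differentiableAt
  have p3 := (r3.2 x hx).1.differentiableAt
  have p5 := (r5.2 x hx).1.differentiableAt
  refine ⟨⟨deriv (fun y => deriv (S.v1 n) y + S.v3 n y + (l : ℂ) * S.v5 n y) x, ?_, ?_⟩,
    ⟨deriv (deriv (S.v3 n)) x, ?_, ?_⟩,
    ⟨deriv (fun y => deriv (S.v5 n) y - (l : ℂ) * S.v1 n y) x, ?_, ?_⟩⟩
  · have hd : DifferentiableAt ℝ (fun y => deriv (S.v1 n) y + S.v3 n y + (l : ℂ) * S.v5 n y) x :=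
      (q1.add p3).add (p5.const_mul _)
    refine hd.hasDerivAt.congr_of_eventuallyEq ?_
    filter_upwards [e1] with y hy
    rw [hy]
  · have := S.eq2 n x hm
    rw [hmu, e5.self_of_nhds] at this
    exact this
  · exact q3.hasDerivAt.congr_of_eventuallyEq e3.symm
  · have := S.eq4 n x hm
    rw [hmu, e1.self_of_nhds] at this
    exact this
  · have hd : DifferentiableAt ℝ (fun y => deriv (S.v5 n) y - (l : ℂ) * S.v1 n y) x :=
      q5.sub (p1.const_mul _)
    refine hd.hasDerivAt.congr_of_eventuallyEq ?_
    filter_upwards [e5] with y hy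
    rw [hy]
  · have := S.eq6 n x hm
    rw [hmu, e1.self_of_nhds] at this
    rw [← this]
    split_ifs <;> simp

lemma bl_dv {v w f : ℝ → ℂ} {L β lam mu : ℝ} {dv df : ℂ} {x : ℝ} (hx : x ∈ Ioo 0 L) (hb : x ≠ β)
    (h : ∀ y ∈ Ioo (0 : ℝ) β ∪ Ioo β L, Complex.I * (lam : ℂ) * v y - w y = (mu : ℂ) * f y)
    (hv : HasDerivAt v dv x) (hf : HasDerivAt f df x) :
    HasDerivAt w (Complex.I * (lam : ℂ) * dv - (mu : ℂ) * df) x := by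
  have : HasDerivAt (fun y => Complex.I * (lam : ℂ) * v y - (mu : ℂ) * f y)
      (Complex.I * (lam : ℂ) * dv - (mu : ℂ) * df) x := (hv.const_mul _).sub (hf.const_mul _)
  refine this.congr_of_eventuallyEq ?_
  filter_upwards [(isOpen_Ioo.union isOpen_Ioo).mem_nhds (bl_mem hx hb)] with y hy
  linear_combination -(h y hy)

lemma bl_energy {ρ₁ ρ₂ k₁ k₂ k₃ l L β a₀ : ℝ} {ℓ : ℕ} 
    (hrho1 : 0 < ρ₁) (hrho2 : 0 < ρ₂) (hk1 : 0 < k₁) (hk2 : 0 < k₂) (hk3 : 0 < k₃)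
    (hL : 0 < L) (hbeta : 0 < β)
    (hbetaL : β < L) (S : BresseSetting ρ₁ ρ₂ k₁ k₂ k₃ l L β a₀ ℓ) (n : ℕ) (mu : ℝ)
    (hmu : (S.lam n : ℂ) ^ (-(ℓ : ℤ)) = (mu : ℂ)) (hmu0 : 0 < mu) {δ : ℝ} (hδ : 0 < δ) :
    a₀ * ∫ x in (0 : ℝ)..β, ‖S.v6 n x‖ ^ 2 ≤ mu * (δ * (∫ x in (0 : ℝ)..L,
      (k₁ * ‖bl_D L (S.v1 n) x + S.v3 n x + (l : ℂ) * S.v5 n x‖ ^ 2 + ρ₁ * ‖S.v2 n x‖ ^ 2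
        + k₂ * ‖bl_D L (S.v3 n) x‖ ^ 2 + ρ₂ * ‖S.v4 n x‖ ^ 2
        + k₃ * ‖bl_D L (S.v5 n) x - (l : ℂ) * S.v1 n x‖ ^ 2 + ρ₁ * ‖S.v6 n x‖ ^ 2))
      + 1 / δ * (∫ x in (0 : ℝ)..L,
      (k₁ * ‖bl_D L (S.f1 n) x + S.f3 n x + (l : ℂ) * S.f5 n x‖ ^ 2 + ρ₁ * ‖S.f2 n x‖ ^ 2
        + k₂ * ‖bl_D L (S.f3 n) x‖ ^ 2 + ρ₂ * ‖S.f4 n x‖ ^ 2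
        + k₃ * ‖bl_D L (S.f5 n) x - (l : ℂ) * S.f1 n x‖ ^ 2 + ρ₁ * ‖S.f6 n x‖ ^ 2))) := by
  obtain ⟨-, z2, -, z4, -, z6, -⟩ := S.bc_zero n
  obtain ⟨-, y2, -, y4, -, y6, -⟩ := S.bc_L n
  have r1 := bl_reg1 hL ((S.reg_v1 n).of_le one_le_two)
  have r3 := bl_reg1 hL ((S.reg_v3 n).of_le one_le_two)
  have r5 := bl_reg1 hL (S.reg_v5 n)
  have rf1 := bl_reg1 hL (S.reg_f1 n)
  have rf3 := bl_reg1 hL (S.reg_f3 n)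
  have rf5 := bl_reg1 hL (S.reg_f5 n)
  have hder := fun x (hx : x ∈ Ioo 0 L) hb => bl_derivs hL hbeta hbetaL S n mu hmu hx hb
  have h1 := S.eq1 n
  have h3 := S.eq3 n
  have h5 := S.eq5 n
  rw [hmu] at h1 h3 h5
  have c1 := (S.reg_v1 n).continuousOn
  have c2 := (S.reg_v2 n).continuousOn
  have c3 := (S.reg_v3 n).continuousOn
  have c4 := (S.reg_v4 n).continuousOn
  have c5 := (S.reg_v5 n).continuousOn
  have c6 := (S.reg_v6 n).continuousOn
  have cf1 := (S.reg_f1 n).continuousOn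
  have cf2 := (S.reg_f2 n)
  have cf3 := (S.reg_f3 n).continuousOn
  have cf4 := (S.reg_f4 n)
  have cf5 := (S.reg_f5 n).continuousOn
  have cf6 := (S.reg_f6 n)
  have d1 : ∀ x ∈ Ioo 0 L, HasDerivAt (S.v1 n) (bl_D L (S.v1 n) x) x := fun x hx => (r1.2 x hx).1
  have d3 : ∀ x ∈ Ioo 0 L, HasDerivAt (S.v3 n) (bl_D L (S.v3 n) x) x := fun x hx => (r3.2 x hx).1
  have d5 : ∀ x ∈ Ioo 0 L, HasDerivAt (S.v5 n) (bl_D L (S.v5 n) x) x := fun x hx => (r5.2 x hx).1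
  have df1 : ∀ x ∈ Ioo 0 L, HasDerivAt (S.f1 n) (bl_D L (S.f1 n) x) x := fun x hx => (rf1.2 x hx).1
  have df3 : ∀ x ∈ Ioo 0 L, HasDerivAt (S.f3 n) (bl_D L (S.f3 n) x) x := fun x hx => (rf3.2 x hx).1
  have df5 : ∀ x ∈ Ioo 0 L, HasDerivAt (S.f5 n) (bl_D L (S.f5 n) x) x := fun x hx => (rf5.2 x hx).1
  have cd1 : ContinuousOn (bl_D L (S.v1 n)) (Icc 0 L) := r1.1
  have cd3 : ContinuousOn (bl_D L (S.v3 n)) (Icc 0 L) := r3.1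
  have cd5 : ContinuousOn (bl_D L (S.v5 n)) (Icc 0 L) := r5.1
  have ce1 : ContinuousOn (bl_D L (S.f1 n)) (Icc 0 L) := rf1.1
  have ce3 : ContinuousOn (bl_D L (S.f3 n)) (Icc 0 L) := rf3.1
  have ce5 : ContinuousOn (bl_D L (S.f5 n)) (Icc 0 L) := rf5.1
  clear r1 r3 r5 rf1 rf3 rf5
  generalize S.v1 n = v1 at *
  generalize S.v2 n = v2 at *
  generalize S.v3 n = v3 at *
  generalize S.v4 n = v4 at *
  generalize S.v5 n = v5 at *
  generalize S.v6 n = v6 at *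
  generalize S.f1 n = f1 at *
  generalize S.f2 n = f2 at *
  generalize S.f3 n = f3 at *
  generalize S.f4 n = f4 at *
  generalize S.f5 n = f5 at *
  generalize S.f6 n = f6 at *
  generalize S.lam n = lam at *
  generalize bl_D L v1 = dv1 at *
  generalize bl_D L v3 = dv3 at *
  generalize bl_D L v5 = dv5 at *
  generalize bl_D L f1 = e1 at *
  generalize bl_D L f3 = e3 at *
  generalize bl_D L f5 = e5 at *
  have cS : ContinuousOn (fun x => dv1 x + v3 x + (l : ℂ) * v5 x) (Icc 0 L) :=
    (cd1.add c3).add (continuousOn_const.mul c5)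
  have cT : ContinuousOn (fun x => dv5 x - (l : ℂ) * v1 x) (Icc 0 L) :=
    cd5.sub (continuousOn_const.mul c1)
  have cE : ContinuousOn (fun x => e1 x + f3 x + (l : ℂ) * f5 x) (Icc 0 L) :=
    (ce1.add cf3).add (continuousOn_const.mul cf5)
  have cU : ContinuousOn (fun x => e5 x - (l : ℂ) * f1 x) (Icc 0 L) :=
    ce5.sub (continuousOn_const.mul cf1)
  set R : ℝ → ℝ := fun x => k₁ * inner ℝ (dv1 x + v3 x + (l : ℂ) * v5 x)
        (e1 x + f3 x + (l : ℂ) * f5 x)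
      + ρ₁ * inner ℝ (v2 x) (f2 x) + k₂ * inner ℝ (dv3 x) (e3 x) + ρ₂ * inner ℝ (v4 x) (f4 x)
      + k₃ * inner ℝ (dv5 x - (l : ℂ) * v1 x) (e5 x - (l : ℂ) * f1 x)
      + ρ₁ * inner ℝ (v6 x) (f6 x) with hR
  have cR : ContinuousOn R (Icc 0 L) := by
    have a1 := cS.inner (𝕜 := ℝ) cE
    have a2 := c2.inner (𝕜 := ℝ) cf2
    have a3 := cd3.inner (𝕜 := ℝ) ce3
    have a4 := c4.inner (𝕜 := ℝ) cf4
    have a5 := cT.inner (𝕜 := ℝ) cU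
    have a6 := c6.inner (𝕜 := ℝ) cf6
    exact (((((continuousOn_const.mul a1).add (continuousOn_const.mul a2)).add
      (continuousOn_const.mul a3)).add (continuousOn_const.mul a4)).add
      (continuousOn_const.mul a5)).add (continuousOn_const.mul a6)
  have iR : IntervalIntegrable R volume 0 L := bl_ii hL.le cR
  have i6 := bl_isq hL.le c6
  have sub1 : uIcc 0 β ⊆ uIcc 0 L := by
    rw [uIcc_of_le hbeta.le, uIcc_of_le hL.le]; exact Icc_subset_Icc le_rfl hbetaL.le
  have i6l : IntervalIntegrable (fun x => ‖v6 x‖ ^ 2) volume 0 β := i6.mono_set sub1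
  have eqa : EqOn (fun x => a₀ * ‖v6 x‖ ^ 2) (fun x => (if x < β then a₀ else 0) * ‖v6 x‖ ^ 2)
      (Ioo 0 β) := by
    intro x hx
    simp [hx.2]
  have eqb : EqOn (fun x => (0 : ℝ)) (fun x => (if x < β then a₀ else 0) * ‖v6 x‖ ^ 2)
      (Ioo β L) := by
    intro x hx
    simp [not_lt.2 hx.1.le]
  have ia : IntervalIntegrable (fun x => (if x < β then a₀ else 0) * ‖v6 x‖ ^ 2) volume 0 β :=
    (i6l.const_mul a₀).congr_uIoo (by rwa [uIoo_of_le hbeta.le])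
  have ib : IntervalIntegrable (fun x => (if x < β then a₀ else 0) * ‖v6 x‖ ^ 2) volume β L :=
    (intervalIntegrable_const (c := (0 : ℝ))).congr_uIoo (by rwa [uIoo_of_le hbetaL.le])
  have iaL := ia.trans ib
  have ea : ∫ x in (0 : ℝ)..L, (if x < β then a₀ else 0) * ‖v6 x‖ ^ 2
      = a₀ * ∫ x in (0 : ℝ)..β, ‖v6 x‖ ^ 2 := by
    rw [← intervalIntegral.integral_add_adjacent_intervals ia ib,
      ← intervalIntegral.integral_congr_Ioo_of_le hbeta.le eqa,
      ← intervalIntegral.integral_congr_Ioo_of_le hbetaL.le eqb,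
      intervalIntegral.integral_const_mul]
    simp
  have key := bl_ftc (β := β) (G := fun x => k₁ * inner ℝ (dv1 x + v3 x + (l : ℂ) * v5 x) (v2 x)
      + k₂ * inner ℝ (dv3 x) (v4 x) + k₃ * inner ℝ (dv5 x - (l : ℂ) * v1 x) (v6 x))
      (h := fun x => (if x < β then a₀ else 0) * ‖v6 x‖ ^ 2 - mu * R x) hL.le
      (((continuousOn_const.mul (cS.inner (𝕜 := ℝ) c2)).add (continuousOn_const.mul (cd3.inner (𝕜 := ℝ) c4))).add
        (continuousOn_const.mul (cT.inner (𝕜 := ℝ) c6))) ?_ (iaL.sub (iR.const_mul mu))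
      (by simp [z2, z4, z6]) (by simp [y2, y4, y6])
  · rw [intervalIntegral.integral_sub iaL (iR.const_mul mu), ea,
      intervalIntegral.integral_const_mul] at key
    have e : a₀ * ∫ x in (0 : ℝ)..β, ‖v6 x‖ ^ 2 = mu * ∫ x in (0 : ℝ)..L, R x := by linarith
    rw [e]
    refine mul_le_mul_of_nonneg_left ?_ hmu0.le
    have iN := (((((((bl_isq hL.le cS).const_mul k₁).add ((bl_isq hL.le c2).const_mul ρ₁)).add
      ((bl_isq hL.le cd3).const_mul k₂)).add
      ((bl_isq hL.le c4).const_mul ρ₂)).add ((bl_isq hL.le cT).const_mul k₃)).add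
      ((bl_isq hL.le c6).const_mul ρ₁))
    have iF := (((((((bl_isq hL.le cE).const_mul k₁).add ((bl_isq hL.le cf2).const_mul ρ₁)).add
      ((bl_isq hL.le ce3).const_mul k₂)).add
      ((bl_isq hL.le cf4).const_mul ρ₂)).add ((bl_isq hL.le cU).const_mul k₃)).add
      ((bl_isq hL.le cf6).const_mul ρ₁))
    rw [← intervalIntegral.integral_const_mul, ← intervalIntegral.integral_const_mul,
      ← intervalIntegral.integral_add (iN.const_mul δ) (iF.const_mul (1 / δ))]
    apply intervalIntegral.integral_mono_on hL.le iR ((iN.const_mul δ).add (iF.const_mul (1 / δ)))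
    intro x _
    have b1 := mul_le_mul_of_nonneg_left (bl_young (dv1 x + v3 x + (l : ℂ) * v5 x)
      (e1 x + f3 x + (l : ℂ) * f5 x) hδ) hk1.le
    have b2 := mul_le_mul_of_nonneg_left (bl_young (v2 x) (f2 x) hδ) hrho1.le
    have b3 := mul_le_mul_of_nonneg_left (bl_young (dv3 x) (e3 x) hδ) hk2.le
    have b4 := mul_le_mul_of_nonneg_left (bl_young (v4 x) (f4 x) hδ) hrho2.le
    have b5 := mul_le_mul_of_nonneg_left (bl_young (dv5 x - (l : ℂ) * v1 x)
      (e5 x - (l : ℂ) * f1 x) hδ) hk3.le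
    have b6 := mul_le_mul_of_nonneg_left (bl_young (v6 x) (f6 x) hδ) hrho1.le
    simp only [hR]
    refine (add_le_add (add_le_add (add_le_add (add_le_add (add_le_add b1 b2) b3) b4) b5) b6).trans
      (le_of_eq ?_)
    ring
  · intro x hx hb
    obtain ⟨⟨s1, hs1, g2⟩, ⟨t3, ht3, g4⟩, ⟨s5, hs5, g6⟩⟩ := hder x hx hb
    have hm := bl_mem hx hb
    have w2 := bl_dv hx hb h1 (d1 x hx) (df1 x hx)
    have w4 := bl_dv hx hb h3 (d3 x hx) (df3 x hx)
    have w6 := bl_dv hx hb h5 (d5 x hx) (df5 x hx)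
    have alg := bl_alg1 lam mu ρ₁ ρ₂ k₁ k₂ k₃ l (if x < β then a₀ else 0) (v1 x) (v2 x) (v3 x)
      (v4 x) (v5 x) (v6 x) (dv1 x) (dv3 x) (dv5 x) (f1 x) (f2 x) (f3 x) (f4 x) (f5 x) (f6 x)
      (e1 x) (e3 x) (e5 x) s1 t3 s5 (h1 x hm) (h3 x hm) (h5 x hm) g2 g4 g6
    refine HasDerivAt.congr_deriv ((((hs1.inner ℝ w2).const_mul k₁).add
      ((ht3.inner ℝ w4).const_mul k₂)).add ((hs5.inner ℝ w6).const_mul k₃)) alg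

lemma bl_smul (k : ℝ) (z w : ℂ) : inner ℝ ((k : ℂ) * z) w = k * inner ℝ z w := by
  simp only [Complex.inner, Complex.mul_re, Complex.mul_im, Complex.ofReal_re,
    Complex.ofReal_im, Complex.conj_re, Complex.conj_im]
  ring

lemma bl_alg2 {lam mu M ρ₁ k₁ k₃ l a₀ β q q' δ : ℝ} (v5 v6 d1 d5 S1 f5 f6 : ℂ)
    (hrho1 : 0 < ρ₁) (hk1 : 0 < k₁) (hk3 : 0 < k₃) (hl : 0 < l) (ha0 : 0 < a₀) (hbeta : 0 < β)
    (hδ : 0 < δ) (hmu : 0 < mu) (hmu1 : mu ≤ 1) (hM : 0 ≤ M) (hM1 : M ≤ 1 / mu)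
    (hM2 : M ^ 2 ≤ lam ^ 2 / mu) (hq0 : 0 ≤ q) (hq : q ≤ β ^ 2) (hq' : |q'| ≤ β)
    (h5 : Complex.I * (lam : ℂ) * v5 - v6 = (mu : ℂ) * f5) :
    M * (-(k₃ * q' * inner ℝ d5 v5 + q * inner ℝ (Complex.I * (lam : ℂ) * (ρ₁ : ℂ) * v6
      + (l : ℂ) * (k₃ : ℂ) * d1 + (l : ℂ) * (k₁ : ℂ) * S1 + (a₀ : ℂ) * v6
      - (ρ₁ : ℂ) * (mu : ℂ) * f6) v5))
    ≤ (β * k₃ + β ^ 2 * (ρ₁ + l * k₁ + l * k₃ + a₀)) *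
      (δ * (‖d5‖ ^ 2 + ‖S1‖ ^ 2 + ‖d1‖ ^ 2 + ‖v6‖ ^ 2 + ‖f6‖ ^ 2)
        + (2 + 10 / δ) * (1 / mu * ‖v6‖ ^ 2 + ‖f5‖ ^ 2)) := by
  set kt := Complex.I * (lam : ℂ) * (ρ₁ : ℂ) * v6
      + (l : ℂ) * (k₃ : ℂ) * d1 + (l : ℂ) * (k₁ : ℂ) * S1 + (a₀ : ℂ) * v6
      - (ρ₁ : ℂ) * (mu : ℂ) * f6 with hkt
  set τ := 1 / mu * ‖v6‖ ^ 2 + ‖f5‖ ^ 2 with hτ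
  have hτ0 : 0 ≤ τ := by positivity
  have n5 := norm_nonneg v5
  have lv : |lam| * ‖v5‖ ≤ ‖v6‖ + mu * ‖f5‖ := by
    have e : Complex.I * (lam : ℂ) * v5 = v6 + (mu : ℂ) * f5 := by linear_combination h5
    calc |lam| * ‖v5‖ = ‖Complex.I * (lam : ℂ) * v5‖ := by simp
      _ = ‖v6 + (mu : ℂ) * f5‖ := by rw [e]
      _ ≤ ‖v6‖ + ‖(mu : ℂ) * f5‖ := norm_add_le _ _
      _ = _ := by simp [abs_of_pos hmu]
  have mi : 1 / mu * mu = 1 := by field_simp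
  have mi1 : 1 ≤ 1 / mu := by rw [le_div_iff₀ hmu]; linarith
  -- the top order term
  have T1 : M * (|lam| * ‖v6‖ * ‖v5‖) ≤ 2 * τ := by
    have a1 : M * (|lam| * ‖v6‖ * ‖v5‖) ≤ 1 / mu * (‖v6‖ * (‖v6‖ + mu * ‖f5‖)) := by
      have : |lam| * ‖v6‖ * ‖v5‖ ≤ ‖v6‖ * (‖v6‖ + mu * ‖f5‖) := by
        calc |lam| * ‖v6‖ * ‖v5‖ = ‖v6‖ * (|lam| * ‖v5‖) := by ring
          _ ≤ _ := by gcongr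
      exact mul_le_mul hM1 this (by positivity) (by positivity)
    have a2 : 1 / mu * (‖v6‖ * (‖v6‖ + mu * ‖f5‖)) = 1 / mu * ‖v6‖ ^ 2 + ‖v6‖ * ‖f5‖ := by
      field_simp
    have a3 : ‖v6‖ ^ 2 ≤ 1 / mu * ‖v6‖ ^ 2 := le_mul_of_one_le_left (by positivity) mi1
    nlinarith [sq_nonneg (‖v6‖ - ‖f5‖), sq_nonneg ‖v6‖, sq_nonneg ‖f5‖]
  have T2 : M ^ 2 * ‖v5‖ ^ 2 ≤ 2 * τ := by
    have a1 : M ^ 2 * ‖v5‖ ^ 2 ≤ 1 / mu * (|lam| * ‖v5‖) ^ 2 := by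
      calc M ^ 2 * ‖v5‖ ^ 2 ≤ lam ^ 2 / mu * ‖v5‖ ^ 2 := by gcongr
        _ = 1 / mu * (|lam| * ‖v5‖) ^ 2 := by rw [mul_pow, sq_abs]; ring
    have a2 : (|lam| * ‖v5‖) ^ 2 ≤ 2 * ‖v6‖ ^ 2 + 2 * (mu * ‖f5‖) ^ 2 := by
      have : (|lam| * ‖v5‖) ^ 2 ≤ (‖v6‖ + mu * ‖f5‖) ^ 2 := by gcongr
      nlinarith [sq_nonneg (‖v6‖ - mu * ‖f5‖)]
    have a3 : 1 / mu * (2 * ‖v6‖ ^ 2 + 2 * (mu * ‖f5‖) ^ 2)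
        = 2 * (1 / mu * ‖v6‖ ^ 2) + 2 * (mu * ‖f5‖ ^ 2) := by field_simp
    have a4 : mu * ‖f5‖ ^ 2 ≤ ‖f5‖ ^ 2 := mul_le_of_le_one_left (by positivity) hmu1
    have a5 := mul_le_mul_of_nonneg_left a2 (by positivity : 0 ≤ 1 / mu)
    linarith
  have Y : ∀ z : ℂ, M * (‖z‖ * ‖v5‖) ≤ δ * ‖z‖ ^ 2 + 2 * τ / δ := by
    intro z
    have e : δ * ‖z‖ ^ 2 + M ^ 2 * ‖v5‖ ^ 2 / δ - M * (‖z‖ * ‖v5‖)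
        = ((δ * ‖z‖ - M * ‖v5‖) ^ 2 + δ * ‖z‖ * (M * ‖v5‖)) / δ := by field_simp; ring
    have e0 : 0 ≤ ((δ * ‖z‖ - M * ‖v5‖) ^ 2 + δ * ‖z‖ * (M * ‖v5‖)) / δ := by positivity
    have e1 : M ^ 2 * ‖v5‖ ^ 2 / δ ≤ 2 * τ / δ := by gcongr
    linarith
  have nk : ‖kt‖ ≤ ρ₁ * (|lam| * ‖v6‖) + l * k₃ * ‖d1‖ + l * k₁ * ‖S1‖ + a₀ * ‖v6‖
      + ρ₁ * ‖f6‖ := by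
    have b : ρ₁ * mu * ‖f6‖ ≤ ρ₁ * ‖f6‖ := by
      have : ρ₁ * mu ≤ ρ₁ := by nlinarith
      gcongr
    calc ‖kt‖ ≤ ‖Complex.I * (lam : ℂ) * (ρ₁ : ℂ) * v6‖ + ‖(l : ℂ) * (k₃ : ℂ) * d1‖
          + ‖(l : ℂ) * (k₁ : ℂ) * S1‖ + ‖(a₀ : ℂ) * v6‖ + ‖(ρ₁ : ℂ) * (mu : ℂ) * f6‖ := by
          rw [hkt]
          refine (norm_sub_le _ _).trans (add_le_add_left ?_ _)
          refine (norm_add_le _ _).trans (add_le_add_left ?_ _)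
          refine (norm_add_le _ _).trans (add_le_add_left ?_ _)
          exact norm_add_le _ _
      _ = |lam| * ρ₁ * ‖v6‖ + l * k₃ * ‖d1‖ + l * k₁ * ‖S1‖ + a₀ * ‖v6‖ + ρ₁ * mu * ‖f6‖ := by
          simp [abs_of_pos hmu, abs_of_pos hrho1, abs_of_pos hl, abs_of_pos hk1, abs_of_pos hk3,
            abs_of_pos ha0]
      _ ≤ _ := by linarith
  have X1 : -(k₃ * q' * inner ℝ d5 v5) ≤ β * k₃ * (‖d5‖ * ‖v5‖) := by
    refine (neg_le_abs _).trans ?_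
    rw [abs_mul, abs_mul, abs_of_pos hk3]
    have := abs_real_inner_le_norm d5 v5
    calc k₃ * |q'| * |inner ℝ d5 v5| ≤ k₃ * β * (‖d5‖ * ‖v5‖) := by gcongr
      _ = _ := by ring
  have X2 : -(q * inner ℝ kt v5) ≤ β ^ 2 * (‖kt‖ * ‖v5‖) := by
    refine (neg_le_abs _).trans ?_
    rw [abs_mul, abs_of_nonneg hq0]
    have := abs_real_inner_le_norm kt v5
    gcongr
  have X3 : ‖kt‖ * ‖v5‖ ≤ ρ₁ * (|lam| * ‖v6‖ * ‖v5‖) + l * k₃ * (‖d1‖ * ‖v5‖)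
      + l * k₁ * (‖S1‖ * ‖v5‖) + a₀ * (‖v6‖ * ‖v5‖) + ρ₁ * (‖f6‖ * ‖v5‖) := by
    have := mul_le_mul_of_nonneg_right nk n5
    linarith
  have X4 : -(k₃ * q' * inner ℝ d5 v5 + q * inner ℝ kt v5) ≤ β * k₃ * (‖d5‖ * ‖v5‖)
      + β ^ 2 * (ρ₁ * (|lam| * ‖v6‖ * ‖v5‖) + l * k₃ * (‖d1‖ * ‖v5‖)
      + l * k₁ * (‖S1‖ * ‖v5‖) + a₀ * (‖v6‖ * ‖v5‖) + ρ₁ * (‖f6‖ * ‖v5‖)) := by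
    have := mul_le_mul_of_nonneg_left X3 (by positivity : 0 ≤ β ^ 2)
    linarith
  have X5 := mul_le_mul_of_nonneg_left X4 hM
  set A := β * k₃ + β ^ 2 * (ρ₁ + l * k₁ + l * k₃ + a₀) with hA
  have pos1 : 0 ≤ β * k₃ := by positivity
  have pos2 : 0 ≤ β ^ 2 * ρ₁ := by positivity
  have pos3 : 0 ≤ β ^ 2 * (l * k₁) := by positivity
  have pos4 : 0 ≤ β ^ 2 * (l * k₃) := by positivity
  have pos5 : 0 ≤ β ^ 2 * a₀ := by positivity
  have comb : ∀ c s t : ℝ, 0 ≤ c → c ≤ A → 0 ≤ t → s ≤ t → c * s ≤ A * t := by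
    intro c s t hc hcA ht hst
    calc c * s ≤ c * t := by gcongr
      _ ≤ A * t := by gcongr
  have td : ∀ z : ℂ, 0 ≤ δ * ‖z‖ ^ 2 + 2 * τ / δ := fun z => by positivity
  have c1 := comb _ _ _ pos1 (by rw [hA]; linarith) (td d5) (Y d5)
  have c2 := comb _ _ _ pos2 (by rw [hA]; linarith) (by positivity) T1
  have c3 := comb _ _ _ pos4 (by rw [hA]; linarith) (td d1) (Y d1)
  have c4 := comb _ _ _ pos3 (by rw [hA]; linarith) (td S1) (Y S1)
  have c5 := comb _ _ _ pos5 (by rw [hA]; linarith) (td v6) (Y v6)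
  have c6 := comb _ _ _ pos2 (by rw [hA]; linarith) (td f6) (Y f6)
  have fin : A * (δ * (‖d5‖ ^ 2 + ‖S1‖ ^ 2 + ‖d1‖ ^ 2 + ‖v6‖ ^ 2 + ‖f6‖ ^ 2)
        + (2 + 10 / δ) * τ) = A * (δ * ‖d5‖ ^ 2 + 2 * τ / δ) + A * (2 * τ)
        + A * (δ * ‖d1‖ ^ 2 + 2 * τ / δ) + A * (δ * ‖S1‖ ^ 2 + 2 * τ / δ)
        + A * (δ * ‖v6‖ ^ 2 + 2 * τ / δ) + A * (δ * ‖f6‖ ^ 2 + 2 * τ / δ) := by ring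
  rw [fin]
  linarith

lemma bl_step2 {ρ₁ ρ₂ k₁ k₂ k₃ l L β a₀ : ℝ} {ℓ : ℕ}
    (hrho1 : 0 < ρ₁) (hk1 : 0 < k₁) (hk3 : 0 < k₃)
    (hl : 0 < l) (ha0 : 0 < a₀) (hL : 0 < L) (hbeta : 0 < β)
    (hbetaL : β < L) (S : BresseSetting ρ₁ ρ₂ k₁ k₂ k₃ l L β a₀ ℓ) (n : ℕ) (mu M : ℝ)
    (hmu : (S.lam n : ℂ) ^ (-(ℓ : ℤ)) = (mu : ℂ)) (hmu0 : 0 < mu) (hmu1 : mu ≤ 1) (hM : 0 ≤ M)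
    (hM1 : M ≤ 1 / mu) (hM2 : M ^ 2 ≤ (S.lam n) ^ 2 / mu) {δ : ℝ} (hδ : 0 < δ) :
    M * (k₃ * ∫ x in (0 : ℝ)..β, x * (β - x) * ‖bl_D L (S.v5 n) x‖ ^ 2) ≤
    (β * k₃ + β ^ 2 * (ρ₁ + l * k₁ + l * k₃ + a₀)) *
      (δ * ((∫ x in (0 : ℝ)..L, (‖S.v5 n x‖ ^ 2 + ‖bl_D L (S.v1 n) x‖ ^ 2
        + ‖bl_D L (S.v5 n) x‖ ^ 2
        + ‖bl_D L (S.v1 n) x + S.v3 n x + (l : ℂ) * S.v5 n x‖ ^ 2 + ‖S.v6 n x‖ ^ 2))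
        + ∫ x in (0 : ℝ)..L, (‖S.f5 n x‖ ^ 2 + ‖bl_D L (S.f1 n) x‖ ^ 2
        + ‖bl_D L (S.f5 n) x‖ ^ 2
        + ‖bl_D L (S.f1 n) x + S.f3 n x + (l : ℂ) * S.f5 n x‖ ^ 2 + ‖S.f6 n x‖ ^ 2))
      + (2 + 10 / δ) * (1 / mu * (∫ x in (0 : ℝ)..β, ‖S.v6 n x‖ ^ 2)
        + ∫ x in (0 : ℝ)..L, (‖S.f5 n x‖ ^ 2 + ‖bl_D L (S.f1 n) x‖ ^ 2
        + ‖bl_D L (S.f5 n) x‖ ^ 2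
        + ‖bl_D L (S.f1 n) x + S.f3 n x + (l : ℂ) * S.f5 n x‖ ^ 2 + ‖S.f6 n x‖ ^ 2))) := by
  have r1 := bl_reg1 hL ((S.reg_v1 n).of_le one_le_two)
  have r5 := bl_reg1 hL (S.reg_v5 n)
  have rf1 := bl_reg1 hL (S.reg_f1 n)
  have rf5 := bl_reg1 hL (S.reg_f5 n)
  have hder := fun x (hx : x ∈ Ioo 0 L) hb => (bl_derivs hL hbeta hbetaL S n mu hmu hx hb).2.2
  have h5 := S.eq5 n
  rw [hmu] at h5
  have c3 := (S.reg_v3 n).continuousOn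
  have c5 := (S.reg_v5 n).continuousOn
  have c6 := (S.reg_v6 n).continuousOn
  have cf3 := (S.reg_f3 n).continuousOn
  have cf5 := (S.reg_f5 n).continuousOn
  have cf6 := (S.reg_f6 n)
  have d1 : ∀ x ∈ Ioo 0 L, HasDerivAt (S.v1 n) (bl_D L (S.v1 n) x) x := fun x hx => (r1.2 x hx).1
  have d5 : ∀ x ∈ Ioo 0 L, HasDerivAt (S.v5 n) (bl_D L (S.v5 n) x) x := fun x hx => (r5.2 x hx).1
  have cd1 : ContinuousOn (bl_D L (S.v1 n)) (Icc 0 L) := r1.1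
  have cd5 : ContinuousOn (bl_D L (S.v5 n)) (Icc 0 L) := r5.1
  have ce1 : ContinuousOn (bl_D L (S.f1 n)) (Icc 0 L) := rf1.1
  have ce5 : ContinuousOn (bl_D L (S.f5 n)) (Icc 0 L) := rf5.1
  clear r1 r5 rf1 rf5
  generalize S.v1 n = v1 at *
  generalize S.v3 n = v3 at *
  generalize S.v5 n = v5 at *
  generalize S.v6 n = v6 at *
  generalize S.f1 n = f1 at *
  generalize S.f3 n = f3 at *
  generalize S.f5 n = f5 at *
  generalize S.f6 n = f6 at *
  generalize S.lam n = lam at *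
  generalize bl_D L v1 = dv1 at *
  generalize bl_D L v5 = dv5 at *
  generalize bl_D L f1 = e1 at *
  generalize bl_D L f5 = e5 at *
  have cS : ContinuousOn (fun x => dv1 x + v3 x + (l : ℂ) * v5 x) (Icc 0 L) :=
    (cd1.add c3).add (continuousOn_const.mul c5)
  have cE : ContinuousOn (fun x => e1 x + f3 x + (l : ℂ) * f5 x) (Icc 0 L) :=
    (ce1.add cf3).add (continuousOn_const.mul cf5)
  set kt : ℝ → ℂ := fun x => Complex.I * (lam : ℂ) * (ρ₁ : ℂ) * v6 x
      + (l : ℂ) * (k₃ : ℂ) * dv1 x + (l : ℂ) * (k₁ : ℂ) * (dv1 x + v3 x + (l : ℂ) * v5 x)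
      + (a₀ : ℂ) * v6 x - (ρ₁ : ℂ) * (mu : ℂ) * f6 x with hkt
  have ckt : ContinuousOn kt (Icc 0 L) :=
    ((((continuousOn_const.mul c6).add (continuousOn_const.mul cd1)).add
      (continuousOn_const.mul cS)).add (continuousOn_const.mul c6)).sub
      (continuousOn_const.mul cf6)
  have sub : Icc 0 β ⊆ Icc 0 L := Icc_subset_Icc le_rfl hbetaL.le
  have cq : ContinuousOn (fun x : ℝ => x * (β - x)) (Icc 0 β) := by fun_prop
  have cq' : ContinuousOn (fun x : ℝ => k₃ * (β - 2 * x)) (Icc 0 β) := by fun_prop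
  have ci1 : ContinuousOn (fun x => k₃ * (β - 2 * x) * inner ℝ (dv5 x) (v5 x)
      + x * (β - x) * inner ℝ (kt x) (v5 x)) (Icc 0 β) :=
    (cq'.mul ((cd5.mono sub).inner (𝕜 := ℝ) (c5.mono sub))).add
      (cq.mul ((ckt.mono sub).inner (𝕜 := ℝ) (c5.mono sub)))
  have ii1 := bl_ii hbeta.le ci1
  have ci2 : ContinuousOn (fun x => x * (β - x) * ‖dv5 x‖ ^ 2) (Icc 0 β) :=
    cq.mul ((cd5.mono sub).norm.pow 2)
  have ii2 := bl_ii hbeta.le ci2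
  have key := bl_ftc (β := 0) (G := fun x => k₃ * (x * (β - x)) * inner ℝ (dv5 x) (v5 x))
      (h := fun x => k₃ * (x * (β - x) * ‖dv5 x‖ ^ 2) + (k₃ * (β - 2 * x) * inner ℝ (dv5 x) (v5 x)
        + x * (β - x) * inner ℝ (kt x) (v5 x))) hbeta.le
      ((continuousOn_const.mul cq).mul ((cd5.mono sub).inner (𝕜 := ℝ) (c5.mono sub)))
      ?_ ((ii2.const_mul k₃).add ii1) (by simp) (by simp)
  · rw [intervalIntegral.integral_add (ii2.const_mul k₃) ii1,
      intervalIntegral.integral_const_mul] at key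
    have e : M * (k₃ * ∫ x in (0 : ℝ)..β, x * (β - x) * ‖dv5 x‖ ^ 2)
        = ∫ x in (0 : ℝ)..β, M * (-(k₃ * (β - 2 * x) * inner ℝ (dv5 x) (v5 x)
          + x * (β - x) * inner ℝ (kt x) (v5 x))) := by
      rw [intervalIntegral.integral_const_mul, intervalIntegral.integral_neg]
      congr 1
      linarith
    rw [e]
    have iU := ((((bl_isq hL.le c5).add (bl_isq hL.le cd1)).add (bl_isq hL.le cd5)).add
      (bl_isq hL.le cS)).add (bl_isq hL.le c6)
    have iF := ((((bl_isq hL.le cf5).add (bl_isq hL.le ce1)).add (bl_isq hL.le ce5)).add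
      (bl_isq hL.le cE)).add (bl_isq hL.le cf6)
    have sub1 : uIcc 0 β ⊆ uIcc 0 L := by
      rw [uIcc_of_le hbeta.le, uIcc_of_le hL.le]; exact sub
    have iUb := iU.mono_set sub1
    have iFb := iF.mono_set sub1
    have i6b := bl_isq hbeta.le (c6.mono sub)
    have mU := intervalIntegral.integral_mono_interval (μ := volume) le_rfl hbeta.le hbetaL.le
      (Eventually.of_forall fun x => by
        simp only [Pi.zero_apply]
        positivity) iU
    have mF := intervalIntegral.integral_mono_interval (μ := volume) le_rfl hbeta.le hbetaL.le
      (Eventually.of_forall fun x => by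
        simp only [Pi.zero_apply]
        positivity) iF
    set A := β * k₃ + β ^ 2 * (ρ₁ + l * k₁ + l * k₃ + a₀) with hA
    have hA0 : 0 ≤ A := by positivity
    have bd := intervalIntegral.integral_mono_on_of_le_Ioo hbeta.le
      (ii1.neg.const_mul M) ((((iUb.add iFb).const_mul δ).add
        (((i6b.const_mul (1 / mu)).add iFb).const_mul (2 + 10 / δ))).const_mul A) (by
        intro x hx
        have a2 := bl_alg2 (q := x * (β - x)) (q' := β - 2 * x) (v5 x) (v6 x) (dv1 x) (dv5 x)
          (dv1 x + v3 x + (l : ℂ) * v5 x) (f5 x) (f6 x)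
          hrho1 hk1 hk3 hl ha0 hbeta hδ hmu0 hmu1 hM hM1 hM2
          (mul_nonneg hx.1.le (by linarith [hx.2]))
          (by nlinarith [hx.1, hx.2, mul_pos hx.1 hx.1])
          (by rw [abs_le]; constructor <;> linarith [hx.1, hx.2])
          (h5 x (Or.inl hx))
        refine a2.trans (mul_le_mul_of_nonneg_left (add_le_add
          (mul_le_mul_of_nonneg_left ?_ hδ.le) (mul_le_mul_of_nonneg_left ?_ (by positivity))) hA0)
        · have g1 := sq_nonneg ‖v5 x‖
          have g2 := sq_nonneg ‖f5 x‖
          have g3 := sq_nonneg ‖e1 x‖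
          have g4 := sq_nonneg ‖e5 x‖
          have g5 := sq_nonneg ‖e1 x + f3 x + (l : ℂ) * f5 x‖
          linarith
        · have g2 := sq_nonneg ‖f6 x‖
          have g3 := sq_nonneg ‖e1 x‖
          have g4 := sq_nonneg ‖e5 x‖
          have g5 := sq_nonneg ‖e1 x + f3 x + (l : ℂ) * f5 x‖
          linarith)
    refine bd.trans ?_
    rw [intervalIntegral.integral_const_mul, intervalIntegral.integral_add
      ((iUb.add iFb).const_mul δ) (((i6b.const_mul (1 / mu)).add iFb).const_mul (2 + 10 / δ)),
      intervalIntegral.integral_const_mul, intervalIntegral.integral_const_mul,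
      intervalIntegral.integral_add iUb iFb,
      intervalIntegral.integral_add (i6b.const_mul (1 / mu)) iFb,
      intervalIntegral.integral_const_mul]
    refine mul_le_mul_of_nonneg_left (add_le_add
          (mul_le_mul_of_nonneg_left (add_le_add mU mF) hδ.le) (mul_le_mul_of_nonneg_left
          (add_le_add le_rfl mF) (by positivity))) hA0
  · intro x hx _
    have hxL : x ∈ Ioo 0 L := ⟨hx.1, hx.2.trans hbetaL⟩
    obtain ⟨s5, hs5, g6⟩ := hder x hxL hx.2.ne
    have ht : HasDerivAt dv5 (s5 + (l : ℂ) * dv1 x) x := by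
      refine (hs5.add ((d1 x hxL).const_mul (l : ℂ))).congr_of_eventuallyEq ?_
      filter_upwards with y
      simp
    have ek : kt x = (k₃ : ℂ) * (s5 + (l : ℂ) * dv1 x) := by
      rw [if_pos hx.2] at g6
      simp only [hkt]
      linear_combination g6
    have hq : HasDerivAt (fun x : ℝ => k₃ * (x * (β - x))) (k₃ * (β - 2 * x)) x := by
      refine (((hasDerivAt_id x).mul ((hasDerivAt_const x β).sub
        (hasDerivAt_id x))).const_mul k₃).congr_deriv ?_
      simp only [id, Pi.sub_apply]
      ring
    refine (hq.mul (ht.inner ℝ (d5 x hxL))).congr_deriv ?_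
    rw [ek, bl_smul, real_inner_self_eq_norm_sq]
    ring

theorem bresse_lemma2_estimate (ρ₁ ρ₂ k₁ k₂ k₃ l L β a₀ : ℝ) (ℓ : ℕ)
    (hrho1 : 0 < ρ₁) (hrho2 : 0 < ρ₂) (hk1 : 0 < k₁) (hk2 : 0 < k₂) (hk3 : 0 < k₃)
    (hl : 0 < l) (hL : 0 < L) (ha0 : 0 < a₀) (hbeta : 0 < β) (hbetaL : β < L)
    (S : BresseSetting ρ₁ ρ₂ k₁ k₂ k₃ l L β a₀ ℓ)
    (hH : (k₁ / ρ₁ = k₂ / ρ₂ ∧ k₁ = k₃ ∧ ℓ = 0) ∨ (k₁ / ρ₁ = k₂ / ρ₂ ∧ k₁ ≠ k₃ ∧ ℓ = 2) ∨ (k₁ / ρ₁ ≠ k₂ / ρ₂ ∧ ℓ = 4)) :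
    ∀ ε : ℝ, 0 < ε → ε < β / 12 →
    Tendsto (fun n => |S.lam n| ^ (min (ℓ / 2 + 1) ℓ) *
      ∫ x in ε..(β - ε), ‖deriv (S.v5 n) x‖ ^ 2) atTop (nhds 0) := by
  intro ε hε hεβ
  obtain ⟨p, hp⟩ : ∃ p : ℕ, ℓ = 2 * p := by
    rcases hH with h | h | h
    · exact ⟨0, by omega⟩
    · exact ⟨1, by omega⟩
    · exact ⟨2, by omega⟩
  obtain ⟨m, hm⟩ : ∃ m, m = min (ℓ / 2 + 1) ℓ := ⟨_, rfl⟩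
  have hm1 : m ≤ ℓ := by omega
  have hm2 : 2 * m ≤ ℓ + 2 := by omega
  rw [← hm]
  -- the weight
  obtain ⟨mu, hmudef⟩ : ∃ mu : ℕ → ℝ, ∀ n, mu n = 1 / |S.lam n| ^ ℓ := ⟨_, fun n => rfl⟩
  have habs : ∀ n, 0 < |S.lam n| := fun n => abs_pos.2 (S.lam_ne n)
  have hmu0 : ∀ n, 0 < mu n := fun n => by rw [hmudef]; have := habs n; positivity
  have hinv : ∀ n, 1 / mu n = |S.lam n| ^ ℓ := fun n => by rw [hmudef, one_div_one_div]
  have heven : Even ℓ := ⟨p, by omega⟩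
  have hmu : ∀ n, (S.lam n : ℂ) ^ (-(ℓ : ℤ)) = (mu n : ℂ) := fun n => by
    rw [hmudef, heven.pow_abs, zpow_neg, zpow_natCast]
    push_cast
    rw [one_div]
  have hge : ∀ᶠ n in atTop, 1 ≤ |S.lam n| := S.lam_tendsto.eventually_ge_atTop 1
  -- norms in terms of bl_D
  obtain ⟨NF, hNF⟩ : ∃ NF : ℕ → ℝ, ∀ n, NF n = ∫ x in (0 : ℝ)..L,
      (k₁ * ‖bl_D L (S.f1 n) x + S.f3 n x + (l : ℂ) * S.f5 n x‖ ^ 2 + ρ₁ * ‖S.f2 n x‖ ^ 2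
        + k₂ * ‖bl_D L (S.f3 n) x‖ ^ 2 + ρ₂ * ‖S.f4 n x‖ ^ 2
        + k₃ * ‖bl_D L (S.f5 n) x - (l : ℂ) * S.f1 n x‖ ^ 2 + ρ₁ * ‖S.f6 n x‖ ^ 2) :=
    ⟨_, fun n => rfl⟩
  obtain ⟨QF, hQF⟩ : ∃ QF : ℕ → ℝ, ∀ n, QF n =
      ∫ x in (0 : ℝ)..L, (‖S.f5 n x‖ ^ 2 + ‖bl_D L (S.f1 n) x‖ ^ 2
        + ‖bl_D L (S.f5 n) x‖ ^ 2
        + ‖bl_D L (S.f1 n) x + S.f3 n x + (l : ℂ) * S.f5 n x‖ ^ 2 + ‖S.f6 n x‖ ^ 2) :=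
    ⟨_, fun n => rfl⟩
  have r1 := fun n => bl_reg1 hL ((S.reg_v1 n).of_le one_le_two)
  have r3 := fun n => bl_reg1 hL ((S.reg_v3 n).of_le one_le_two)
  have r5 := fun n => bl_reg1 hL (S.reg_v5 n)
  have rf1 := fun n => bl_reg1 hL (S.reg_f1 n)
  have rf3 := fun n => bl_reg1 hL (S.reg_f3 n)
  have rf5 := fun n => bl_reg1 hL (S.reg_f5 n)
  have hNU : ∀ n, ∫ x in (0 : ℝ)..L,
      (k₁ * ‖bl_D L (S.v1 n) x + S.v3 n x + (l : ℂ) * S.v5 n x‖ ^ 2 + ρ₁ * ‖S.v2 n x‖ ^ 2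
        + k₂ * ‖bl_D L (S.v3 n) x‖ ^ 2 + ρ₂ * ‖S.v4 n x‖ ^ 2
        + k₃ * ‖bl_D L (S.v5 n) x - (l : ℂ) * S.v1 n x‖ ^ 2 + ρ₁ * ‖S.v6 n x‖ ^ 2) = 1 := by
    intro n
    rw [← S.normU n]
    refine intervalIntegral.integral_congr_Ioo_of_le hL.le fun x hx => ?_
    simp only [bl_D, ← ((r1 n).2 x hx).2, ← ((r3 n).2 x hx).2, ← ((r5 n).2 x hx).2]
  have hNF0 : Tendsto NF atTop (nhds 0) := by
    refine S.normF.congr fun n => ?_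
    rw [hNF]
    refine intervalIntegral.integral_congr_Ioo_of_le hL.le fun x hx => ?_
    simp only [bl_D, ← ((rf1 n).2 x hx).2, ← ((rf3 n).2 x hx).2, ← ((rf5 n).2 x hx).2]
  have hNFn : ∀ n, 0 ≤ NF n := fun n => by
    rw [hNF]
    exact intervalIntegral.integral_nonneg hL.le fun x _ => by positivity
  have hQFn : ∀ n, 0 ≤ QF n := fun n => by
    rw [hQF]
    exact intervalIntegral.integral_nonneg hL.le fun x _ => by positivity
  -- energy dissipation
  have hX : Tendsto (fun n => 1 / mu n * ∫ x in (0 : ℝ)..β, ‖S.v6 n x‖ ^ 2) atTop (nhds 0) := by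
    refine bl_lim (A := 1 / a₀) (B := 0) (by positivity) hNF0 (Eventually.of_forall fun n => ?_)
      (Eventually.of_forall fun n δ hδ => ?_)
    · exact mul_nonneg (one_div_nonneg.2 (hmu0 n).le)
        (intervalIntegral.integral_nonneg hbeta.le fun x _ => by positivity)
    · have h := bl_energy hrho1 hrho2 hk1 hk2 hk3 hL hbeta hbetaL S n (mu n) (hmu n) (hmu0 n) hδ
      rw [hNU n, ← hNF n] at h
      have hm0 := hmu0 n
      rw [div_mul_eq_mul_div, one_mul, div_le_iff₀ hm0]
      have e : (1 / a₀ * δ + (0 + 1 / a₀ / δ) * NF n) * mu n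
          = (mu n * (δ * 1 + 1 / δ * NF n)) / a₀ := by
        field_simp
        ring
      rw [e, le_div_iff₀ ha0]
      linarith
  obtain ⟨C, hC, hcoer⟩ := bl_coer (ρ₁ := ρ₁) (ρ₂ := ρ₂) (k₁ := k₁) (k₂ := k₂) (k₃ := k₃) l hL
    hrho1 hrho2 hk1 hk2 hk3
  have hQU : ∀ n, ∫ x in (0 : ℝ)..L, (‖S.v5 n x‖ ^ 2 + ‖bl_D L (S.v1 n) x‖ ^ 2
        + ‖bl_D L (S.v5 n) x‖ ^ 2
        + ‖bl_D L (S.v1 n) x + S.v3 n x + (l : ℂ) * S.v5 n x‖ ^ 2 + ‖S.v6 n x‖ ^ 2) ≤ C := by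
    intro n
    obtain ⟨z1, -, z3, -, z5, -⟩ := S.bc_zero n
    have h := hcoer (S.v1 n) (S.v2 n) (S.v3 n) (S.v4 n) (S.v5 n) (S.v6 n) (bl_D L (S.v1 n))
      (bl_D L (S.v3 n)) (bl_D L (S.v5 n)) (S.reg_v1 n).continuousOn (S.reg_v2 n).continuousOn
      (S.reg_v3 n).continuousOn (S.reg_v4 n).continuousOn (S.reg_v5 n).continuousOn
      (S.reg_v6 n).continuousOn (r1 n).1 (r3 n).1 (r5 n).1 z1 z3 z5
      (fun x hx => ((r1 n).2 x hx).1) (fun x hx => ((r3 n).2 x hx).1)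
      (fun x hx => ((r5 n).2 x hx).1)
    rwa [hNU n, mul_one] at h
  have hQF1 : ∀ n, QF n ≤ C * NF n := by
    intro n
    obtain ⟨-, -, -, -, -, -, z1, z3, z5⟩ := S.bc_zero n
    have h := hcoer (S.f1 n) (S.f2 n) (S.f3 n) (S.f4 n) (S.f5 n) (S.f6 n) (bl_D L (S.f1 n))
      (bl_D L (S.f3 n)) (bl_D L (S.f5 n)) (S.reg_f1 n).continuousOn (S.reg_f2 n)
      (S.reg_f3 n).continuousOn (S.reg_f4 n) (S.reg_f5 n).continuousOn
      (S.reg_f6 n) (rf1 n).1 (rf3 n).1 (rf5 n).1 z1 z3 z5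
      (fun x hx => ((rf1 n).2 x hx).1) (fun x hx => ((rf3 n).2 x hx).1)
      (fun x hx => ((rf5 n).2 x hx).1)
    rwa [← hNF n, ← hQF n] at h
  have hQF0 : Tendsto QF atTop (nhds 0) := by
    refine squeeze_zero hQFn hQF1 ?_
    simpa using hNF0.const_mul C
  obtain ⟨T, hTdef⟩ : ∃ T : ℕ → ℝ, ∀ n, T n =
      1 / mu n * (∫ x in (0 : ℝ)..β, ‖S.v6 n x‖ ^ 2) + QF n := ⟨_, fun n => rfl⟩
  have hT : Tendsto T atTop (nhds 0) := by
    have := hX.add hQF0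
    rw [add_zero] at this
    exact this.congr fun n => (hTdef n).symm
  have hTn : ∀ n, 0 ≤ T n := fun n => by
    rw [hTdef]
    exact add_nonneg (mul_nonneg (one_div_nonneg.2 (hmu0 n).le)
        (intervalIntegral.integral_nonneg hbeta.le fun x _ => by positivity)) (hQFn n)
  -- localisation
  have hεb : ε ≤ β - ε := by linarith
  have hc0 : 0 < ε * (β - ε) := mul_pos hε (by linarith)
  have hloc : ∀ n, ε * (β - ε) * (∫ x in ε..(β - ε), ‖deriv (S.v5 n) x‖ ^ 2) ≤
      ∫ x in (0 : ℝ)..β, x * (β - x) * ‖bl_D L (S.v5 n) x‖ ^ 2 := by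
    intro n
    have cD : ContinuousOn (bl_D L (S.v5 n)) (Icc 0 L) := (r5 n).1
    have e : ∫ x in ε..(β - ε), ‖deriv (S.v5 n) x‖ ^ 2
        = ∫ x in ε..(β - ε), ‖bl_D L (S.v5 n) x‖ ^ 2 := by
      refine intervalIntegral.integral_congr_Ioo_of_le hεb fun x hx => ?_
      have hx2 : x ∈ Ioo 0 L := ⟨by linarith [hx.1], by linarith [hx.2]⟩
      simp only [bl_D, ← ((r5 n).2 x hx2).2]
    have cq : ContinuousOn (fun x => x * (β - x) * ‖bl_D L (S.v5 n) x‖ ^ 2) (Icc 0 β) :=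
      (continuousOn_id.mul (continuousOn_const.sub continuousOn_id)).mul
        ((cD.mono (Icc_subset_Icc le_rfl hbetaL.le)).norm.pow 2)
    have sub : Icc ε (β - ε) ⊆ Icc 0 β := Icc_subset_Icc hε.le (by linarith)
    rw [e, ← intervalIntegral.integral_const_mul]
    refine le_trans (intervalIntegral.integral_mono_on hεb
      (bl_ii hεb (continuousOn_const.mul
        ((cD.mono (sub.trans (Icc_subset_Icc le_rfl hbetaL.le))).norm.pow 2)))
      (bl_ii hεb (cq.mono sub)) (fun x hx => ?_)) ?_
    · refine mul_le_mul_of_nonneg_right ?_ (by positivity)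
      nlinarith [mul_nonneg (sub_nonneg.2 hx.1) (sub_nonneg.2 hx.2)]
    · refine intervalIntegral.integral_mono_interval hε.le hεb (by linarith) ?_
        (bl_ii hbeta.le cq)
      refine (ae_restrict_iff' measurableSet_Ioc).2 (Eventually.of_forall fun x hx => ?_)
      have h1 : 0 ≤ x := hx.1.le
      have h2 : 0 ≤ β - x := sub_nonneg.2 hx.2
      show 0 ≤ x * (β - x) * ‖bl_D L (S.v5 n) x‖ ^ 2
      positivity
  -- conclusion
  obtain ⟨K, hK⟩ : ∃ K, K = β * k₃ + β ^ 2 * (ρ₁ + l * k₁ + l * k₃ + a₀) := ⟨_, rfl⟩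
  have hK0 : 0 < K := by rw [hK]; positivity
  obtain ⟨c, hc⟩ : ∃ c, c = k₃ * (ε * (β - ε)) := ⟨_, rfl⟩
  have hcpos : 0 < c := by rw [hc]; positivity
  refine bl_lim (A := K * (C + 11) / c) (B := 2 * K / c) (by positivity) hT
    (Eventually.of_forall fun n => mul_nonneg (by positivity)
      (intervalIntegral.integral_nonneg hεb fun x _ => by positivity)) ?_
  filter_upwards [hge, hQF0.eventually_le_const zero_lt_one] with n hn hq δ hδ
  have hm0 := hmu0 n
  have hs := bl_step2 hrho1 hk1 hk3 hl ha0 hL hbeta hbetaL S n (mu n) (|S.lam n| ^ m) (hmu n) hm0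
    (by
      rw [hmudef, div_le_one (by positivity)]
      exact one_le_pow₀ hn) (by positivity)
    (by rw [hinv]; exact pow_le_pow_right₀ hn hm1)
    (by
      rw [div_eq_mul_one_div, hinv, ← sq_abs (S.lam n), ← pow_mul, ← pow_add]
      exact pow_le_pow_right₀ hn (by omega)) hδ
  rw [← hQF n, ← hTdef n, ← hK] at hs
  have hl2 := hloc n
  have hu := hQU n
  have ht := hTn n
  have hM0 : 0 ≤ |S.lam n| ^ m := by positivity
  have step : c * (|S.lam n| ^ m * ∫ x in ε..(β - ε), ‖deriv (S.v5 n) x‖ ^ 2) ≤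
      |S.lam n| ^ m * (k₃ * ∫ x in (0 : ℝ)..β, x * (β - x) * ‖bl_D L (S.v5 n) x‖ ^ 2) := by
    have := mul_le_mul_of_nonneg_left (mul_le_mul_of_nonneg_left hl2 hk3.le) hM0
    rw [hc]
    linarith
  have b1 : K * (δ * ((∫ x in (0 : ℝ)..L, (‖S.v5 n x‖ ^ 2 + ‖bl_D L (S.v1 n) x‖ ^ 2
        + ‖bl_D L (S.v5 n) x‖ ^ 2
        + ‖bl_D L (S.v1 n) x + S.v3 n x + (l : ℂ) * S.v5 n x‖ ^ 2 + ‖S.v6 n x‖ ^ 2)) + QF n)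
        + (2 + 10 / δ) * T n) ≤ K * (δ * (C + 11) + (2 + (C + 11) / δ) * T n) := by
    refine mul_le_mul_of_nonneg_left (add_le_add (mul_le_mul_of_nonneg_left (by linarith) hδ.le)
      (mul_le_mul_of_nonneg_right ?_ ht)) hK0.le
    have : 10 / δ ≤ (C + 11) / δ := div_le_div_of_nonneg_right (by linarith) hδ.le
    linarith
  have fin := step.trans (hs.trans b1)
  rw [← le_div_iff₀' hcpos] at fin
  refine fin.trans (le_of_eq ?_)
  field_simp
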